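/- Let g be odd, Γ̄ the tropical hyperelliptic curve of genus g, Γ its bounded part, and D* = ((g−1)/2)(V_0 + V_0′) + V_0. The divisor V_0 + V_2 + V_4 + ⋯ + V_{g−1} + V_2′ + V_4′ + ⋯ + V_{g−1}′ lies in 𝔇̃_g^+(Γ) and is the unique element of 𝔇̃_g^+(Γ) whose image under φ̄ is 0 in J(Γ); hence the g-tuple (V_0, V_2, V_4, …, V_{g−1}, V_2′, V_4′, …, V_{g−1}′) is the unit 𝒪 of the group (Γ_g^+, 𝒪). -/

import Mathlib

open scoped BigOperators

namespace TropicalHyperelliptic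

/-! ## The tropical hyperelliptic curve

For a genus `g ≥ 1` and parameters `c₋₁, c₀, …, c_{g+1}` (encoded as a function
`c : ℤ → ℝ`; only the values `c (-1), …, c (g+1)` matter), the tropical
polynomial `F̃(X,Y) = max(2Y, Y + P̃(X), c₋₁)` with
`P̃(X) = max_{0 ≤ i ≤ g+1} (c_i + iX)` defines the tropical hyperelliptic curve
`Γ̄` as the locus of points of `ℝ²` where `F̃` fails to be differentiable. -/

/-- The tropical polynomial `P̃(X) = max_{0 ≤ i ≤ g+1} (c_i + i X)`. -/
noncomputable def Ptilde (g : ℕ) (c : ℤ → ℝ) (X : ℝ) : ℝ :=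
  (Finset.range (g + 2)).sup' (Finset.nonempty_range_iff.mpr (by omega))
    fun i => c (i : ℤ) + (i : ℝ) * X

/-- The tropical polynomial `F̃(X,Y) = max(2Y, Y + P̃(X), c₋₁)`. -/
noncomputable def Ftilde (g : ℕ) (c : ℤ → ℝ) (P : ℝ × ℝ) : ℝ :=
  max (2 * P.2) (max (P.2 + Ptilde g c P.1) (c (-1)))

/-- The tropical hyperelliptic curve `Γ̄` of genus `g`: the set of points of
`ℝ²` at which `F̃` is not differentiable. -/
def curveBar (g : ℕ) (c : ℤ → ℝ) : Set (ℝ × ℝ) :=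
  {P | ¬ DifferentiableAt ℝ (Ftilde g c) P}

/-- The hypotheses on the parameters: `c_{g+1} = c_g = 0`, `c₋₁ < 2c₀`,
`cᵢ + c_{i+2} < 2c_{i+1}` for `0 ≤ i ≤ g − 2`, and `c_{g−1} < 2c_g = 0`.
Under these assumptions `Γ̄` is a smooth tropical curve of genus `g`. -/
def Hyp (g : ℕ) (c : ℤ → ℝ) : Prop :=
  c ((g : ℤ) + 1) = 0 ∧ c (g : ℤ) = 0 ∧ c (-1) < 2 * c 0 ∧
  (∀ i : ℕ, (i : ℤ) ≤ (g : ℤ) - 2 → c i + c ((i : ℤ) + 2) < 2 * c ((i : ℤ) + 1)) ∧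
  c ((g : ℤ) - 1) < 0

/-- The vertices `V_i` (`0 ≤ i ≤ g`) of `Γ̄` lying above the line
`Y = c₋₁/2`:  `V_0 = (0,0)` and
`V_i = (c_{g−i} − c_{g−i+1}, (g−i+1)c_{g−i} − (g−i)c_{g−i+1})`.
(The formula below also gives `V_0 = (0,0)` for `i = 0`, since
`c_g = c_{g+1} = 0`.) -/
noncomputable def V (g : ℕ) (c : ℤ → ℝ) (i : ℕ) : ℝ × ℝ :=
  (c ((g : ℤ) - i) - c ((g : ℤ) - i + 1),
   (((g : ℤ) - i + 1 : ℤ) : ℝ) * c ((g : ℤ) - i)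
     - (((g : ℤ) - i : ℤ) : ℝ) * c ((g : ℤ) - i + 1))

/-- The conjugate `P′` of a point `P`: the reflection with respect to the line
`Y = c₋₁/2`. -/
def conj (c : ℤ → ℝ) (P : ℝ × ℝ) : ℝ × ℝ := (P.1, c (-1) - P.2)

/-- The metric graph `Γ` obtained from `Γ̄` by removing all unbounded edges:
the part of `Γ̄` lying in the vertical strip `x(V_g) ≤ X ≤ x(V_0) = 0`,
where `x(V_g) = c_0 − c_1`. -/
def Gam (g : ℕ) (c : ℤ → ℝ) : Set (ℝ × ℝ) :=
  {P ∈ curveBar g c | c 0 - c 1 ≤ P.1 ∧ P.1 ≤ 0}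

/-! ## Rational functions, orders, and divisors -/

/-- The image in `ℝ²` of an integer vector. -/
def vr (v : ℤ × ℤ) : ℝ × ℝ := ((v.1 : ℝ), (v.2 : ℝ))

/-- The primitive integer directions along which one can leave the point `P`
inside the set `S` (the outgoing directions of the segments of `S` emanating
from `P`). -/
def localDirs (S : Set (ℝ × ℝ)) (P : ℝ × ℝ) : Set (ℤ × ℤ) :=
  {v | IsCoprime v.1 v.2 ∧ ∃ ε > (0 : ℝ), ∀ t : ℝ, 0 < t → t < ε → P + t • vr v ∈ S}

/-- `f` has (integer) outgoing slope `s` at `P` in the direction `v` (slopes are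
measured with respect to the lattice length). -/
def HasSlope (S : Set (ℝ × ℝ)) (f : ℝ × ℝ → ℝ) (P : ℝ × ℝ) (v : ℤ × ℤ) (s : ℤ) : Prop :=
  ∃ ε > (0 : ℝ), ∀ t : ℝ, 0 ≤ t → t < ε → P + t • vr v ∈ S →
    f (P + t • vr v) = f P + (s : ℝ) * t

/-- A rational function on (the tropical curve) `S ⊆ ℝ²`: a continuous function
whose restriction to every edge is piecewise linear with integer slopes,
i.e. which has an integer outgoing slope at every point of `S` in every
outgoing direction. -/
structure IsRationalFn (S : Set (ℝ × ℝ)) (f : ℝ × ℝ → ℝ) : Prop where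
  cont : ContinuousOn f S
  slope_int : ∀ P ∈ S, ∀ v ∈ localDirs S P, ∃ s : ℤ, HasSlope S f P v s

/-- The outgoing slope of `f` at `P` in the direction `v` (defaulting to `0`
when no integer slope exists). -/
noncomputable def slope (S : Set (ℝ × ℝ)) (f : ℝ × ℝ → ℝ) (P : ℝ × ℝ) (v : ℤ × ℤ) : ℤ :=
  open scoped Classical in
  if h : ∃ s : ℤ, HasSlope S f P v s then h.choose else 0

/-- The order `ord_P f`: the sum of the outgoing slopes of `f` over all segments
of `S` emanating from `P`.  Points with `ord_P f > 0` are the zeros of `f`,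
points with `ord_P f < 0` its poles. -/
noncomputable def ord (S : Set (ℝ × ℝ)) (f : ℝ × ℝ → ℝ) (P : ℝ × ℝ) : ℤ :=
  ∑ᶠ v ∈ localDirs S P, slope S f P v

/-- Divisors: formal `ℤ`-linear combinations of finitely many points of `ℝ²`. -/
abbrev Div := (ℝ × ℝ) →₀ ℤ

/-- The degree of a divisor: the sum of its coefficients. -/
def deg (D : Div) : ℤ := D.sum fun _ n => n

/-- A divisor is effective (`D > 0`) when all its coefficients are nonnegative. -/
def Eff (D : Div) : Prop := ∀ P, 0 ≤ D P

/-- `R(D)`: the set of rational functions `f` on `S` with `(f) + D` effective. -/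
def RSet (S : Set (ℝ × ℝ)) (D : Div) : Set ((ℝ × ℝ) → ℝ) :=
  {f | IsRationalFn S f ∧ ∀ P ∈ S, 0 ≤ ord S f P + D P}

/-- A divisor is principal when it is the divisor `(f) = Σ_P (ord_P f)·P` of a
rational function `f` on `S`. -/
def IsPrincipal (S : Set (ℝ × ℝ)) (D : Div) : Prop :=
  ∃ f : (ℝ × ℝ) → ℝ, IsRationalFn S f ∧ ∀ P, D P = ord S f P

/-- Two divisors are (linearly) equivalent, `D ∼ D′`, when `D′ = D + (f)` for
some rational function `f` on `S`. -/
def LinEquiv (S : Set (ℝ × ℝ)) (D D' : Div) : Prop :=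
  ∃ f : (ℝ × ℝ) → ℝ, IsRationalFn S f ∧ ∀ P, D' P = D P + ord S f P

end TropicalHyperelliptic

/-! ## The cycles `α_i` and the set `𝔇̃_g^+(Γ)` -/

namespace TropicalHyperelliptic

/-- The basis cycle `α_i` (`1 ≤ i ≤ g`) of the fundamental group `π₁(Γ)`:
the cycle of `Γ` through the vertices `V_{i−1}`, `V_i` and their conjugates
`V_{i−1}′`, `V_i′`, i.e. the part of `Γ` in the vertical strip
`x(V_i) ≤ X ≤ x(V_{i−1})`. -/
def alphaCycle (g : ℕ) (c : ℤ → ℝ) (i : ℕ) : Set (ℝ × ℝ) :=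
  {P ∈ Gam g c | (V g c i).1 ≤ P.1 ∧ P.1 ≤ (V g c (i - 1)).1}

/-- The overlap `α_{k,k+1} = (α_k ∩ α_{k+1}) ∖ {endpoints}` (`1 ≤ k ≤ g − 1`):
the open vertical edge of `Γ` joining `V_k` to `V_k′`.  (For non-adjacent
indices the overlaps `α_i ∩ α_j` are empty.) -/
def alphaOpen (g : ℕ) (c : ℤ → ℝ) (k : ℕ) : Set (ℝ × ℝ) :=
  {P ∈ Gam g c | P.1 = (V g c k).1 ∧ P ≠ V g c k ∧ P ≠ conj c (V g c k)}

/-- The subset `𝔇̃_g^+(Γ)` of `𝔇_g^+(Γ)`: effective divisors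
`P_1 + ⋯ + P_g` with `P_i ∈ α_i` for all `i`, such that each overlap `α_{ij}`
contains at most one of the points. -/
def Dtilde (g : ℕ) (c : ℤ → ℝ) : Set Div :=
  {D | ∃ Pt : Fin g → ℝ × ℝ,
    (∀ i : Fin g, Pt i ∈ alphaCycle g c (i + 1)) ∧
    (∀ k : ℕ, 1 ≤ k → k ≤ g - 1 →
      ∀ i j : Fin g, Pt i ∈ alphaOpen g c k → Pt j ∈ alphaOpen g c k → i = j) ∧
    D = ∑ i : Fin g, Finsupp.single (Pt i) (1 : ℤ)}

/-- For even `g`, the base divisor `D* = (g/2)(V_0 + V_0′)`. -/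
noncomputable def DstarEven (g : ℕ) (c : ℤ → ℝ) : Div :=
  ((g / 2 : ℕ) : ℤ) •
    (Finsupp.single (V g c 0) (1 : ℤ) + Finsupp.single (conj c (V g c 0)) (1 : ℤ))

/-- For odd `g`, the base divisor `D* = ((g−1)/2)(V_0 + V_0′) + V_0`. -/
noncomputable def DstarOdd (g : ℕ) (c : ℤ → ℝ) : Div :=
  (((g - 1) / 2 : ℕ) : ℤ) •
    (Finsupp.single (V g c 0) (1 : ℤ) + Finsupp.single (conj c (V g c 0)) (1 : ℤ))
  + Finsupp.single (V g c 0) (1 : ℤ)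

end TropicalHyperelliptic

namespace TropicalHyperelliptic

/-- For odd `g`, the divisor
`V_0 + V_2 + V_4 + ⋯ + V_{g−1} + V_2′ + V_4′ + ⋯ + V_{g−1}′`. -/
noncomputable def OdivOdd (g : ℕ) (c : ℤ → ℝ) : Div :=
  Finsupp.single (V g c 0) (1 : ℤ)
  + ∑ j : Fin ((g - 1) / 2),
      (Finsupp.single (V g c (2 * (j : ℕ) + 2)) (1 : ℤ)
        + Finsupp.single (conj c (V g c (2 * (j : ℕ) + 2))) (1 : ℤ))

end TropicalHyperelliptic

namespace TropProof
open TropicalHyperelliptic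

/-! ## Basic geometry of the curve -/

/-- abscissa of the `k`-th rung, from left to right -/
noncomputable def bb (c : ℤ → ℝ) (k : ℕ) : ℝ := c (k : ℤ) - c ((k : ℤ) + 1)

lemma bb_top {g : ℕ} {c : ℤ → ℝ} (hc : Hyp g c) : bb c g = 0 := by
  obtain ⟨h1, h2, -⟩ := hc
  simp [bb, h1, h2]

lemma bb_lt {g : ℕ} {c : ℤ → ℝ} (hc : Hyp g c) {k : ℕ} (hk : k < g) : bb c k < bb c (k + 1) := by
  obtain ⟨h1, h2, h3, h4, h5⟩ := hc
  by_cases h : k + 1 < g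
  · have := h4 k (by omega)
    simp only [bb]
    push_cast
    rw [show (k : ℤ) + 1 + 1 = k + 2 by ring]
    linarith
  · obtain rfl : g = k + 1 := by omega
    push_cast at *
    rw [show (k : ℤ) + 1 - 1 = k by ring] at h5
    simp only [bb]
    push_cast
    rw [h1, h2]
    linarith

lemma bb_strict {g : ℕ} {c : ℤ → ℝ} (hc : Hyp g c) {i j : ℕ} (hij : i < j) (hj : j ≤ g) :
    bb c i < bb c j := by
  induction j, hij using Nat.le_induction with
  | base => exact bb_lt hc (by omega)
  | succ n hn ih => exact (ih (by omega)).trans (bb_lt hc (by omega))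

lemma bb_le {g : ℕ} {c : ℤ → ℝ} (hc : Hyp g c) {i j : ℕ} (hij : i ≤ j) (hj : j ≤ g) :
    bb c i ≤ bb c j := by
  rcases hij.lt_or_eq with h | rfl
  · exact (bb_strict hc h hj).le
  · exact le_rfl

lemma bb_lt_iff {g : ℕ} {c : ℤ → ℝ} (hc : Hyp g c) {i j : ℕ} (hi : i ≤ g) (hj : j ≤ g) :
    bb c i < bb c j ↔ i < j :=
  ⟨fun h => by
    by_contra h'
    exact absurd (bb_le hc (not_lt.mp h') hi) (not_le.mpr h), fun h => bb_strict hc h hj⟩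

lemma bb_inj {g : ℕ} {c : ℤ → ℝ} (hc : Hyp g c) {i j : ℕ} (hi : i ≤ g) (hj : j ≤ g)
    (h : bb c i = bb c j) : i = j := by
  rcases lt_trichotomy i j with h' | h' | h'
  · exact absurd h (bb_strict hc h' hj).ne
  · exact h'
  · exact absurd h (bb_strict hc h' hi).ne'

lemma pt_ge (g : ℕ) (c : ℤ → ℝ) (X : ℝ) {i : ℕ} (hi : i ≤ g + 1) :
    c (i : ℤ) + (i : ℝ) * X ≤ Ptilde g c X :=
  Finset.le_sup' (fun i : ℕ => c (i : ℤ) + (i : ℝ) * X) (Finset.mem_range.mpr (by omega))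

lemma pt_eq' (g : ℕ) (c : ℤ → ℝ) (X : ℝ) {k : ℕ} (hk : k ≤ g + 1)
    (h1 : ∀ i < k, bb c i ≤ X) (h2 : ∀ i, k ≤ i → i ≤ g → X ≤ bb c i) :
    Ptilde g c X = c (k : ℤ) + (k : ℝ) * X := by
  apply le_antisymm _ (pt_ge g c X hk)
  apply Finset.sup'_le
  intro i hi
  replace hi : i ≤ g + 1 := by have := Finset.mem_range.mp hi; omega
  rcases le_total i k with h | h
  · clear hi h2
    induction k, h using Nat.le_induction with
    | base => exact le_rfl
    | succ n hn ih =>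
      have h3 := ih (by omega) (fun i hi => h1 i (by omega))
      have h4 := h1 n (by omega)
      simp only [bb] at h4
      push_cast
      linarith
  · induction i, h using Nat.le_induction with
    | base => exact le_rfl
    | succ n hn ih =>
      have h3 := ih (by omega)
      have h4 := h2 n hn (by omega)
      simp only [bb] at h4
      push_cast
      linarith

lemma pt_eq {g : ℕ} {c : ℤ → ℝ} (hc : Hyp g c) {X : ℝ} {k : ℕ} (hk : k < g)
    (h1 : bb c k ≤ X) (h2 : X ≤ bb c (k + 1)) :
    Ptilde g c X = c ((k : ℤ) + 1) + ((k : ℝ) + 1) * X := by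
  have := pt_eq' g c X (k := k + 1) (by omega)
    (fun i hi => (bb_le hc (by omega) (by omega)).trans h1)
    (fun i hi hi' => h2.trans (bb_le hc hi hi'))
  push_cast at this
  exact this

lemma pt_bb {g : ℕ} {c : ℤ → ℝ} (hc : Hyp g c) {k : ℕ} (hk : k ≤ g) :
    Ptilde g c (bb c k) = c (k : ℤ) + (k : ℝ) * bb c k :=
  pt_eq' g c _ (by omega) (fun i hi => bb_le hc (by omega) (by omega))
    (fun i hi hi' => bb_le hc hi hi')

lemma pt_cont (g : ℕ) (c : ℤ → ℝ) : Continuous (Ptilde g c) := by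
  unfold Ptilde
  apply Continuous.finset_sup'_apply
  intro i _
  fun_prop

/-- the half height -/
noncomputable def qq (g : ℕ) (c : ℤ → ℝ) (X : ℝ) : ℝ := Ptilde g c X - c (-1) / 2

lemma qq_pos {g : ℕ} {c : ℤ → ℝ} (hc : Hyp g c) (X : ℝ) : 0 < qq g c X := by
  have := pt_ge g c X (i := 0) (by omega)
  have h3 := hc.2.2.1
  simp at this
  unfold qq
  linarith

lemma qq_cont (g : ℕ) (c : ℤ → ℝ) : Continuous (qq g c) := (pt_cont g c).sub continuous_const

lemma qq_add {g : ℕ} {c : ℤ → ℝ} (hc : Hyp g c) {k : ℕ} (hk : k < g) {x x' : ℝ}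
    (hx : x ∈ Set.Icc (bb c k) (bb c (k + 1))) (hx' : x' ∈ Set.Icc (bb c k) (bb c (k + 1))) :
    qq g c x' = qq g c x + ((k : ℝ) + 1) * (x' - x) := by
  unfold qq
  rw [pt_eq hc hk hx.1 hx.2, pt_eq hc hk hx'.1 hx'.2]
  ring

lemma exists_right {g : ℕ} {c : ℤ → ℝ} (hc : Hyp g c) {x : ℝ} (h0 : bb c 0 ≤ x) (h1 : x < 0) :
    ∃ k < g, bb c k ≤ x ∧ x < bb c (k + 1) := by
  have hex : ∃ k, k ≤ g ∧ x < bb c k := ⟨g, le_rfl, by rw [bb_top hc]; exact h1⟩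
  classical
  have h2 := Nat.find_spec hex
  have h3 : Nat.find hex ≠ 0 := by
    intro h
    rw [h] at h2
    exact absurd h2.2 (not_lt.mpr h0)
  obtain ⟨k, hk⟩ := Nat.exists_eq_succ_of_ne_zero h3
  rw [hk] at h2
  have h4 := Nat.find_min hex (m := k) (by omega)
  refine ⟨k, by omega, ?_, h2.2⟩
  by_contra h
  exact h4 ⟨by omega, not_le.mp h⟩

lemma exists_left {g : ℕ} {c : ℤ → ℝ} (hc : Hyp g c) {x : ℝ} (h0 : bb c 0 < x) (h1 : x ≤ 0) :
    ∃ k < g, bb c k < x ∧ x ≤ bb c (k + 1) := by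
  have hex : ∃ k, k ≤ g ∧ x ≤ bb c k := ⟨g, le_rfl, by rw [bb_top hc]; exact h1⟩
  classical
  have h2 := Nat.find_spec hex
  have h3 : Nat.find hex ≠ 0 := by
    intro h
    rw [h] at h2
    exact absurd h2.2 (not_le.mpr h0)
  obtain ⟨k, hk⟩ := Nat.exists_eq_succ_of_ne_zero h3
  rw [hk] at h2
  have h4 := Nat.find_min hex (m := k) (by omega)
  refine ⟨k, by omega, ?_, h2.2⟩
  by_contra h
  exact h4 ⟨by omega, not_lt.mp h⟩

lemma not_diff_aux {F : ℝ × ℝ → ℝ} {P v : ℝ × ℝ} {m₁ m₂ : ℝ}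
    (hm : m₁ ≠ m₂) (h1 : ∀ t : ℝ, F P + m₁ * t ≤ F (P + t • v))
    (h2 : ∀ t : ℝ, F P + m₂ * t ≤ F (P + t • v)) : ¬ DifferentiableAt ℝ F P := by
  intro hd
  have hd' : DifferentiableAt ℝ (fun t : ℝ => F (P + t • v)) 0 := by
    have : DifferentiableAt ℝ F (P + (0 : ℝ) • v) := by simpa using hd
    exact DifferentiableAt.comp (0 : ℝ) (f := fun t : ℝ => P + t • v) this (by fun_prop)
  have key : ∀ m : ℝ, (∀ t : ℝ, F P + m * t ≤ F (P + t • v)) →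
      deriv (fun t : ℝ => F (P + t • v)) 0 = m := by
    intro m hm
    have hmin : IsLocalMin (fun t : ℝ => F (P + t • v) - m * t) 0 := by
      apply Filter.Eventually.of_forall
      intro t
      have := hm t
      simp
      linarith
    have h0 := hmin.hasDerivAt_eq_zero (hd'.hasDerivAt.sub ((hasDerivAt_id (0 : ℝ)).const_mul m))
    linarith
  exact hm ((key _ h1).symm.trans (key _ h2))

lemma abs_sub_eq_cases {y e q : ℝ} (h : |y - e| = q) : y = e + q ∨ y = e - q := by
  rcases abs_cases (y - e) with ⟨h1, _⟩ | ⟨h1, _⟩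
  · left; linarith
  · right; linarith

lemma mem_Gam {g : ℕ} {c : ℤ → ℝ} (hc : Hyp g c) (P : ℝ × ℝ) :
    P ∈ Gam g c ↔ (bb c 0 ≤ P.1 ∧ P.1 ≤ 0) ∧ (|P.2 - c (-1) / 2| = qq g c P.1 ∨
      ∃ k ≤ g, P.1 = bb c k ∧ |P.2 - c (-1) / 2| ≤ qq g c P.1) := by
  obtain ⟨x, y⟩ := P
  have hq := qq_pos hc x
  have e0 : bb c 0 = c 0 - c 1 := by simp [bb]
  simp only [Gam, Set.mem_ofPred_eq, ← e0]
  rw [and_comm]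
  apply and_congr_right
  rintro ⟨hx0, hx1⟩
  constructor
  · intro hnd
    by_contra hcon
    push Not at hcon
    obtain ⟨hne, hr⟩ := hcon
    apply hnd
    rcases lt_or_gt_of_ne hne with hlt | hgt
    · -- between
      have hnb : ∀ k ≤ g, x ≠ bb c k := fun k hk h => absurd (hr k hk h) (not_lt.mpr hlt.le)
      have hx1' : x < 0 := lt_of_le_of_ne hx1 (by rw [← bb_top hc]; exact hnb g le_rfl)
      obtain ⟨k, hk, h1, h2⟩ := exists_right hc hx0 hx1'
      have h1' : bb c k < x := lt_of_le_of_ne h1 (hnb k hk.le).symm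
      have hopen : IsOpen {P : ℝ × ℝ | bb c k < P.1 ∧ P.1 < bb c (k + 1) ∧
          |P.2 - c (-1) / 2| < qq g c P.1} := by
        have := qq_cont g c
        have h3 : IsOpen {P : ℝ × ℝ | |P.2 - c (-1) / 2| < qq g c P.1} :=
          isOpen_lt (by fun_prop) (by fun_prop)
        exact (isOpen_lt continuous_const continuous_fst).inter
          ((isOpen_lt continuous_fst continuous_const).inter h3)
      have hev : Ftilde g c =ᶠ[nhds (x, y)]
          fun P => P.2 + (c ((k : ℤ) + 1) + ((k : ℝ) + 1) * P.1) := by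
        filter_upwards [hopen.mem_nhds (x := (x, y)) ⟨h1', h2, hlt⟩]
        rintro ⟨x', y'⟩ ⟨ha, hb, hd⟩
        simp only at ha hb hd
        have hp := pt_eq hc hk ha.le hb.le
        rw [abs_lt] at hd
        unfold qq at hd
        simp only [Ftilde]
        rw [max_eq_left (by linarith : c (-1) ≤ y' + Ptilde g c x'), max_eq_right (by linarith), hp]
      refine DifferentiableAt.congr_of_eventuallyEq ?_ hev
      fun_prop
    · rcases lt_abs.mp hgt with h | h
      · have hopen : IsOpen {P : ℝ × ℝ | qq g c P.1 < P.2 - c (-1) / 2} := by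
          have := qq_cont g c
          exact isOpen_lt (by fun_prop) (by fun_prop)
        have hev : Ftilde g c =ᶠ[nhds (x, y)] fun P => 2 * P.2 := by
          filter_upwards [hopen.mem_nhds (x := (x, y)) h]
          rintro ⟨x', y'⟩ hd
          have hq' := qq_pos hc x'
          simp only [Set.mem_ofPred_eq] at hd
          unfold qq at hd hq'
          simp only [Ftilde]
          rw [max_eq_left]
          apply max_le <;> linarith
        refine DifferentiableAt.congr_of_eventuallyEq ?_ hev
        fun_prop
      · have hopen : IsOpen {P : ℝ × ℝ | qq g c P.1 < - (P.2 - c (-1) / 2)} := by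
          have := qq_cont g c
          exact isOpen_lt (by fun_prop) (by fun_prop)
        have hev : Ftilde g c =ᶠ[nhds (x, y)] fun P => c (-1) := by
          filter_upwards [hopen.mem_nhds (x := (x, y)) h]
          rintro ⟨x', y'⟩ hd
          have hq' := qq_pos hc x'
          simp only [Set.mem_ofPred_eq] at hd
          unfold qq at hd hq'
          simp only [Ftilde]
          rw [max_eq_right (b := c (-1)) (by linarith), max_eq_right]
          linarith
        refine DifferentiableAt.congr_of_eventuallyEq ?_ hev
        fun_prop
  · intro h
    have g1 : ∀ X Y : ℝ, 2 * Y ≤ Ftilde g c (X, Y) := fun X Y => le_max_left _ _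
    have g2 : ∀ X Y : ℝ, Y + Ptilde g c X ≤ Ftilde g c (X, Y) :=
      fun X Y => le_max_of_le_right (le_max_left _ _)
    have g3 : ∀ X Y : ℝ, c (-1) ≤ Ftilde g c (X, Y) :=
      fun X Y => le_max_of_le_right (le_max_right _ _)
    have hgraph : |y - c (-1) / 2| = qq g c x → ¬ DifferentiableAt ℝ (Ftilde g c) (x, y) := by
      intro h
      unfold qq at *
      rcases abs_sub_eq_cases h with h | h
      · have hF : Ftilde g c (x, y) = 2 * y := by
          simp only [Ftilde]
          rw [max_eq_left]
          apply max_le <;> linarith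
        apply not_diff_aux (v := (0, 1)) (m₁ := 2) (m₂ := 1) (by norm_num)
        · intro t
          have := g1 x (y + t)
          simp [hF]
          linarith
        · intro t
          have := g2 x (y + t)
          simp [hF]
          linarith
      · have hF : Ftilde g c (x, y) = c (-1) := by
          simp only [Ftilde]
          rw [max_eq_right (b := c (-1)) (by linarith), max_eq_right]
          linarith
        apply not_diff_aux (v := (0, 1)) (m₁ := 1) (m₂ := 0) (by norm_num)
        · intro t
          have := g2 x (y + t)
          simp [hF]
          linarith
        · intro t
          have := g3 x (y + t)
          simp [hF]
          linarith
    rcases h with h | ⟨k, hk, hxk, hle⟩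
    · exact hgraph h
    · rcases hle.lt_or_eq with hlt | heq
      · change x = bb c k at hxk
        change |y - c (-1) / 2| < qq g c x at hlt
        have hp := pt_bb hc hk
        rw [← hxk] at hp
        rw [abs_lt] at hlt
        unfold qq at hlt
        have hF : Ftilde g c (x, y) = y + Ptilde g c x := by
          simp only [Ftilde]
          rw [max_eq_left (by linarith : c (-1) ≤ y + Ptilde g c x), max_eq_right (by linarith)]
        apply not_diff_aux (v := (1, 0)) (m₁ := k) (m₂ := k + 1) (by norm_num)
        · intro t
          have h1 := g2 (x + t) y
          have h2 := pt_ge g c (x + t) (i := k) (by omega)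
          simp [hF]
          nlinarith
        · intro t
          have h1 := g2 (x + t) y
          have h2 := pt_ge g c (x + t) (i := k + 1) (by omega)
          have h3 : x = c (k : ℤ) - c ((k : ℤ) + 1) := hxk
          push_cast at h2
          simp [hF]
          nlinarith
      · exact hgraph heq

lemma Gam_closed {g : ℕ} {c : ℤ → ℝ} (hc : Hyp g c) : IsClosed (Gam g c) := by
  have hqc := qq_cont g c
  have : Gam g c = {P : ℝ × ℝ | bb c 0 ≤ P.1 ∧ P.1 ≤ 0} ∩
      ({P : ℝ × ℝ | |P.2 - c (-1) / 2| = qq g c P.1} ∪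
      ⋃ k ∈ Set.Iic g, ({P : ℝ × ℝ | P.1 = bb c k} ∩
        {P : ℝ × ℝ | |P.2 - c (-1) / 2| ≤ qq g c P.1})) := by
    ext P
    rw [mem_Gam hc]
    simp only [Set.mem_inter_iff, Set.mem_union, Set.mem_iUnion, Set.mem_ofPred_eq, Set.mem_Iic,
      exists_prop]
  rw [this]
  refine IsClosed.inter ?_ (IsClosed.union ?_ ?_)
  · exact (isClosed_le continuous_const continuous_fst).inter
      (isClosed_le continuous_fst continuous_const)
  · exact isClosed_eq (by fun_prop) (by fun_prop)
  · refine (Set.finite_Iic g).isClosed_biUnion fun k _ => IsClosed.inter ?_ ?_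
    · exact isClosed_eq (by fun_prop) (by fun_prop)
    · exact isClosed_le (by fun_prop) (by fun_prop)

lemma localDirs_notMem {g : ℕ} {c : ℤ → ℝ} (hc : Hyp g c) {P : ℝ × ℝ} (hP : P ∉ Gam g c) :
    localDirs (Gam g c) P = ∅ := by
  ext v
  simp only [localDirs, Set.mem_ofPred_eq, Set.mem_empty_iff_false, iff_false]
  rintro ⟨-, ε, hε, h⟩
  apply hP
  have ht : Filter.Tendsto (fun t : ℝ => P + t • vr v) (nhdsWithin 0 (Set.Ioi 0)) (nhds P) := by
    have : Continuous (fun t : ℝ => P + t • vr v) := by fun_prop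
    have h2 := this.tendsto 0
    simp only [zero_smul, add_zero] at h2
    exact h2.mono_left nhdsWithin_le_nhds
  refine (Gam_closed hc).mem_of_tendsto ht ?_
  filter_upwards [Ioo_mem_nhdsGT hε] with t ht
  exact h t ht.1 ht.2

/-! ## Local directions -/

lemma ev_pos : ∀ᶠ t : ℝ in nhdsWithin 0 (Set.Ioi 0), 0 < t := self_mem_nhdsWithin

/-- upper (`σ = 1`) or lower (`σ = -1`) point of the curve above `x` -/
noncomputable def gr (g : ℕ) (c : ℤ → ℝ) (σ : ℤ) (x : ℝ) : ℝ × ℝ :=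
  (x, c (-1) / 2 + (σ : ℝ) * qq g c x)

lemma gr_mem {g : ℕ} {c : ℤ → ℝ} (hc : Hyp g c) {σ : ℤ} (hσ : σ = 1 ∨ σ = -1) {x : ℝ}
    (h0 : bb c 0 ≤ x) (h1 : x ≤ 0) : gr g c σ x ∈ Gam g c := by
  rw [mem_Gam hc]
  refine ⟨⟨h0, h1⟩, Or.inl ?_⟩
  have := qq_pos hc x
  rcases hσ with rfl | rfl <;> simp [gr, abs_of_pos this]

lemma rung_mem {g : ℕ} {c : ℤ → ℝ} (hc : Hyp g c) {k : ℕ} (hk : k ≤ g) {y : ℝ}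
    (h : |y - c (-1) / 2| ≤ qq g c (bb c k)) : (bb c k, y) ∈ Gam g c := by
  rw [mem_Gam hc]
  refine ⟨⟨bb_le hc (by omega) hk, ?_⟩, Or.inr ⟨k, hk, rfl, h⟩⟩
  rw [← bb_top hc]
  exact bb_le hc hk le_rfl

lemma gr_right {g : ℕ} {c : ℤ → ℝ} (hc : Hyp g c) {k : ℕ} (hk : k < g) (σ : ℤ) {x t : ℝ}
    (hx : x ∈ Set.Icc (bb c k) (bb c (k + 1))) (hx' : x + t ∈ Set.Icc (bb c k) (bb c (k + 1))) :
    gr g c σ x + t • vr (1, σ * ((k : ℤ) + 1)) = gr g c σ (x + t) := by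
  have := qq_add hc hk hx hx'
  ext
  · simp [gr, vr]
  · simp [gr, vr, this]
    ring

lemma gr_left {g : ℕ} {c : ℤ → ℝ} (hc : Hyp g c) {k : ℕ} (hk : k < g) (σ : ℤ) {x t : ℝ}
    (hx : x ∈ Set.Icc (bb c k) (bb c (k + 1))) (hx' : x - t ∈ Set.Icc (bb c k) (bb c (k + 1))) :
    gr g c σ x + t • vr (-1, -(σ * ((k : ℤ) + 1))) = gr g c σ (x - t) := by
  have := qq_add hc hk hx hx'
  ext
  · simp [gr, vr]
    ring
  · simp [gr, vr, this]
    ring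

lemma interior_abs {g : ℕ} {c : ℤ → ℝ} (hc : Hyp g c) {k : ℕ} (hk : k < g) {x y : ℝ}
    (hx : x ∈ Set.Ioo (bb c k) (bb c (k + 1))) (h : (x, y) ∈ Gam g c) :
    |y - c (-1) / 2| = qq g c x := by
  rw [mem_Gam hc] at h
  rcases h.2 with h | ⟨j, hj, hxj, -⟩
  · exact h
  · exfalso
    simp only at hxj
    rw [hxj] at hx
    have h1 := (bb_lt_iff hc (by omega) (by omega)).mp hx.1
    have h2 := (bb_lt_iff hc (by omega) (by omega)).mp hx.2
    omega

lemma dir_ev {S : Set (ℝ × ℝ)} {P : ℝ × ℝ} {v : ℤ × ℤ} (h : v ∈ localDirs S P) :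
    ∀ᶠ t : ℝ in nhdsWithin 0 (Set.Ioi 0), P + t • vr v ∈ S := by
  obtain ⟨-, ε, hε, h⟩ := h
  filter_upwards [Ioo_mem_nhdsGT hε] with t ht
  exact h t ht.1 ht.2

lemma dir_abs {g : ℕ} {c : ℤ → ℝ} (hc : Hyp g c) {k : ℕ} (hk : k < g) {x y : ℝ} {a b : ℤ}
    (hx : x ∈ Set.Icc (bb c k) (bb c (k + 1)))
    (hev : ∀ᶠ t : ℝ in nhdsWithin 0 (Set.Ioi 0), x + t * a ∈ Set.Ioo (bb c k) (bb c (k + 1)))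
    (hv : (a, b) ∈ localDirs (Gam g c) (x, y)) :
    ∀ᶠ t : ℝ in nhdsWithin 0 (Set.Ioi 0),
      |y - c (-1) / 2 + t * b| = qq g c x + ((k : ℝ) + 1) * (a * t) := by
  filter_upwards [hev, dir_ev hv] with t h1 h2
  have h3 : (x + t * a, y + t * b) ∈ Gam g c := by
    simpa [vr] using h2
  have h4 := interior_abs hc hk h1 h3
  rw [qq_add hc hk hx ⟨h1.1.le, h1.2.le⟩] at h4
  rw [show y - c (-1) / 2 + t * b = y + t * b - c (-1) / 2 by ring, h4]
  ring

lemma dir_none {g : ℕ} {c : ℤ → ℝ} (hc : Hyp g c) {k : ℕ} (hk : k < g) {x y : ℝ} {a b : ℤ}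
    (hx : x ∈ Set.Icc (bb c k) (bb c (k + 1)))
    (hev : ∀ᶠ t : ℝ in nhdsWithin 0 (Set.Ioi 0), x + t * a ∈ Set.Ioo (bb c k) (bb c (k + 1)))
    (hv : (a, b) ∈ localDirs (Gam g c) (x, y)) : |y - c (-1) / 2| = qq g c x := by
  have h := dir_abs hc hk hx hev hv
  have t1 : Filter.Tendsto (fun t : ℝ => |y - c (-1) / 2 + t * b|) (nhdsWithin 0 (Set.Ioi 0))
      (nhds |y - c (-1) / 2|) := by
    have : Continuous (fun t : ℝ => |y - c (-1) / 2 + t * b|) := by fun_prop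
    have h2 := this.tendsto 0
    simp only [zero_mul, add_zero] at h2
    exact h2.mono_left nhdsWithin_le_nhds
  have t2 : Filter.Tendsto (fun t : ℝ => qq g c x + ((k : ℝ) + 1) * (a * t))
      (nhdsWithin 0 (Set.Ioi 0)) (nhds (qq g c x)) := by
    have : Continuous (fun t : ℝ => qq g c x + ((k : ℝ) + 1) * (a * t)) := by fun_prop
    have h2 := this.tendsto 0
    simp only [mul_zero, add_zero] at h2
    exact h2.mono_left nhdsWithin_le_nhds
  exact tendsto_nhds_unique_of_eventuallyEq t1 t2 h

lemma dir_gr {g : ℕ} {c : ℤ → ℝ} (hc : Hyp g c) {k : ℕ} (hk : k < g) {σ : ℤ}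
    (hσ : σ = 1 ∨ σ = -1) {x : ℝ} {a b : ℤ}
    (hx : x ∈ Set.Icc (bb c k) (bb c (k + 1)))
    (hev : ∀ᶠ t : ℝ in nhdsWithin 0 (Set.Ioi 0), x + t * a ∈ Set.Ioo (bb c k) (bb c (k + 1)))
    (hv : (a, b) ∈ localDirs (Gam g c) (gr g c σ x)) : b = a * (σ * ((k : ℤ) + 1)) := by
  have h := dir_abs hc hk hx hev hv
  have hq := qq_pos hc x
  have hs : ∀ᶠ t : ℝ in nhdsWithin 0 (Set.Ioi 0), 0 < qq g c x + σ * b * t := by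
    have : Continuous (fun t : ℝ => qq g c x + σ * b * t) := by fun_prop
    have h2 := this.tendsto 0
    simp only [mul_zero, add_zero] at h2
    exact (h2.mono_left nhdsWithin_le_nhds).eventually (lt_mem_nhds hq)
  obtain ⟨t, ht, h1, h2⟩ := (ev_pos.and (h.and hs)).exists
  have ht : (0 : ℝ) < t := ht
  have h3 : (b : ℝ) = a * (σ * ((k : ℝ) + 1)) := by
    rcases hσ with rfl | rfl
    · simp at h1 h2
      rw [abs_of_pos (by linarith)] at h1
      have : t * ((b : ℝ) - a * (k + 1)) = 0 := by linarith
      rcases mul_eq_zero.mp this with h | h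
      · linarith
      · simp; linarith
    · simp at h1 h2
      rw [abs_of_neg (by linarith)] at h1
      have : t * ((b : ℝ) + a * (k + 1)) = 0 := by linarith
      rcases mul_eq_zero.mp this with h | h
      · linarith
      · simp; linarith
  exact_mod_cast h3

lemma coprime_mul {a m : ℤ} (h : IsCoprime a (a * m)) : a = 1 ∨ a = -1 :=
  Int.isUnit_iff.mp (h.isUnit_of_dvd' dvd_rfl (dvd_mul_right a m))

lemma ev_right {x a l u : ℝ} (ha : 0 < a) (h1 : l ≤ x) (h2 : x < u) :
    ∀ᶠ t : ℝ in nhdsWithin 0 (Set.Ioi 0), x + t * a ∈ Set.Ioo l u := by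
  have hpos : 0 < (u - x) / a := div_pos (by linarith) ha
  filter_upwards [Ioo_mem_nhdsGT hpos] with t ht
  have h3 := (lt_div_iff₀ ha).mp ht.2
  have h4 := mul_pos ht.1 ha
  constructor <;> linarith

lemma ev_left {x a l u : ℝ} (ha : a < 0) (h1 : l < x) (h2 : x ≤ u) :
    ∀ᶠ t : ℝ in nhdsWithin 0 (Set.Ioi 0), x + t * a ∈ Set.Ioo l u := by
  have ha' : 0 < -a := by linarith
  have hpos : 0 < (x - l) / (-a) := div_pos (by linarith) ha'
  filter_upwards [Ioo_mem_nhdsGT hpos] with t ht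
  have h3 := (lt_div_iff₀ ha').mp ht.2
  have h4 := mul_pos ht.1 ha'
  constructor <;> linarith

lemma dir_x_right {g : ℕ} {c : ℤ → ℝ} (hc : Hyp g c) {x y : ℝ} {a b : ℤ} (ha : 0 < a)
    (hv : (a, b) ∈ localDirs (Gam g c) (x, y)) : x < 0 := by
  obtain ⟨t, ht, h⟩ := (ev_pos.and (dir_ev hv)).exists
  rw [mem_Gam hc] at h
  have h2 := h.1.2
  simp [vr] at h2
  have : 0 < t * (a : ℝ) := mul_pos ht (by exact_mod_cast ha)
  linarith

lemma dir_x_left {g : ℕ} {c : ℤ → ℝ} (hc : Hyp g c) {x y : ℝ} {a b : ℤ} (ha : a < 0)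
    (hv : (a, b) ∈ localDirs (Gam g c) (x, y)) : bb c 0 < x := by
  obtain ⟨t, ht, h⟩ := (ev_pos.and (dir_ev hv)).exists
  rw [mem_Gam hc] at h
  have h2 := h.1.1
  simp [vr] at h2
  have : t * (a : ℝ) < 0 := mul_neg_of_pos_of_neg ht (by exact_mod_cast ha)
  linarith

lemma dir_zero {S : Set (ℝ × ℝ)} {P : ℝ × ℝ} {b : ℤ} (hv : ((0 : ℤ), b) ∈ localDirs S P) :
    b = 1 ∨ b = -1 := by
  have := hv.1
  simp only [isCoprime_zero_left] at this
  exact Int.isUnit_iff.mp this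

lemma right_mem {g : ℕ} {c : ℤ → ℝ} (hc : Hyp g c) {k : ℕ} (hk : k < g) {σ : ℤ}
    (hσ : σ = 1 ∨ σ = -1) {x : ℝ} (h1 : bb c k ≤ x) (h2 : x < bb c (k + 1)) :
    (1, σ * ((k : ℤ) + 1)) ∈ localDirs (Gam g c) (gr g c σ x) := by
  refine ⟨isCoprime_one_left, bb c (k + 1) - x, by linarith, fun t h0 ht => ?_⟩
  rw [gr_right hc hk σ ⟨h1, h2.le⟩ ⟨by linarith, by linarith⟩]
  have := bb_le hc (Nat.zero_le k) hk.le
  have h3 := bb_le hc (i := k + 1) (j := g) (by omega) le_rfl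
  rw [bb_top hc] at h3
  exact gr_mem hc hσ (by linarith) (by linarith)

lemma left_mem {g : ℕ} {c : ℤ → ℝ} (hc : Hyp g c) {k : ℕ} (hk : k < g) {σ : ℤ}
    (hσ : σ = 1 ∨ σ = -1) {x : ℝ} (h1 : bb c k < x) (h2 : x ≤ bb c (k + 1)) :
    (-1, -(σ * ((k : ℤ) + 1))) ∈ localDirs (Gam g c) (gr g c σ x) := by
  refine ⟨isCoprime_one_left.neg_left, x - bb c k, by linarith, fun t h0 ht => ?_⟩
  rw [gr_left hc hk σ ⟨h1.le, h2⟩ ⟨by linarith, by linarith⟩]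
  have := bb_le hc (Nat.zero_le k) hk.le
  have h3 := bb_le hc (i := k + 1) (j := g) (by omega) le_rfl
  rw [bb_top hc] at h3
  exact gr_mem hc hσ (by linarith) (by linarith)

lemma up_mem {g : ℕ} {c : ℤ → ℝ} (hc : Hyp g c) {k : ℕ} (hk : k ≤ g) {y : ℝ}
    (h1 : c (-1) / 2 - qq g c (bb c k) ≤ y) (h2 : y < c (-1) / 2 + qq g c (bb c k)) :
    (0, 1) ∈ localDirs (Gam g c) (bb c k, y) := by
  refine ⟨isCoprime_one_right, c (-1) / 2 + qq g c (bb c k) - y, by linarith, fun t h0 ht => ?_⟩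
  have : (bb c k, y) + t • vr (0, 1) = (bb c k, y + t) := by simp [vr]
  rw [this]
  exact rung_mem hc hk (abs_le.mpr ⟨by linarith, by linarith⟩)

lemma down_mem {g : ℕ} {c : ℤ → ℝ} (hc : Hyp g c) {k : ℕ} (hk : k ≤ g) {y : ℝ}
    (h1 : c (-1) / 2 - qq g c (bb c k) < y) (h2 : y ≤ c (-1) / 2 + qq g c (bb c k)) :
    (0, -1) ∈ localDirs (Gam g c) (bb c k, y) := by
  refine ⟨isCoprime_one_right.neg_right, y - (c (-1) / 2 - qq g c (bb c k)), by linarith,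
    fun t h0 ht => ?_⟩
  have : (bb c k, y) + t • vr (0, -1) = (bb c k, y - t) := by simp [vr, sub_eq_add_neg]
  rw [this]
  exact rung_mem hc hk (abs_le.mpr ⟨by linarith, by linarith⟩)

lemma vert_mem {g : ℕ} {c : ℤ → ℝ} (hc : Hyp g c) {k : ℕ} (hk : k ≤ g) {σ : ℤ}
    (hσ : σ = 1 ∨ σ = -1) : (0, -σ) ∈ localDirs (Gam g c) (gr g c σ (bb c k)) := by
  have hq := qq_pos hc (bb c k)
  rcases hσ with rfl | rfl
  · exact down_mem hc hk (by simp; linarith) (by simp)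
  · exact up_mem hc hk (by simp [sub_eq_add_neg]) (by simp; linarith)

/-- directions at an interior point of a strip edge -/
lemma dirs_strip {g : ℕ} {c : ℤ → ℝ} (hc : Hyp g c) {k : ℕ} (hk : k < g) {σ : ℤ}
    (hσ : σ = 1 ∨ σ = -1) {x : ℝ} (h1 : bb c k < x) (h2 : x < bb c (k + 1)) :
    localDirs (Gam g c) (gr g c σ x) =
      (({(1, σ * ((k : ℤ) + 1)), (-1, -(σ * ((k : ℤ) + 1)))} : Finset (ℤ × ℤ)) : Set (ℤ × ℤ)) := by
  ext ⟨a, b⟩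
  simp only [Finset.coe_insert, Finset.coe_singleton, Set.mem_insert_iff, Set.mem_singleton_iff,
    Prod.mk.injEq]
  constructor
  · intro hv
    rcases lt_trichotomy a 0 with ha | rfl | ha
    · have hb := dir_gr hc hk hσ ⟨h1.le, h2.le⟩
        (ev_left (by exact_mod_cast ha) h1 h2.le) hv
      have hcop := hv.1
      simp only [hb] at hcop
      rcases coprime_mul hcop with rfl | rfl
      · omega
      · right; simp [hb]
    · exfalso
      have hb := dir_gr hc hk hσ ⟨h1.le, h2.le⟩
        (Filter.Eventually.of_forall fun t => by simpa using ⟨h1, h2⟩) hv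
      rcases dir_zero hv with h | h <;> simp [h] at hb
    · have hb := dir_gr hc hk hσ ⟨h1.le, h2.le⟩
        (ev_right (by exact_mod_cast ha) h1.le h2) hv
      have hcop := hv.1
      simp only [hb] at hcop
      rcases coprime_mul hcop with rfl | rfl
      · left; simp [hb]
      · omega
  · rintro (⟨rfl, rfl⟩ | ⟨rfl, rfl⟩)
    · exact right_mem hc hk hσ h1.le h2
    · exact left_mem hc hk hσ h1 h2.le

/-- directions at a vertex -/
lemma dirs_vertex {g : ℕ} {c : ℤ → ℝ} (hc : Hyp g c) {k : ℕ} (hk : k ≤ g) {σ : ℤ}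
    (hσ : σ = 1 ∨ σ = -1) :
    localDirs (Gam g c) (gr g c σ (bb c k)) =
      (((if k < g then {(1, σ * ((k : ℤ) + 1))} else ∅) ∪
        ((if 0 < k then {(-1, -(σ * (k : ℤ)))} else ∅) ∪ {(0, -σ)}) : Finset (ℤ × ℤ)) :
          Set (ℤ × ℤ)) := by
  have hq := qq_pos hc (bb c k)
  ext ⟨a, b⟩
  simp only [Finset.coe_union, Set.mem_union, Finset.mem_coe]
  constructor
  · intro hv
    rcases lt_trichotomy a 0 with ha | rfl | ha
    · have hx := dir_x_left hc ha hv
      have hk0 := (bb_lt_iff hc (by omega) hk).mp hx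
      obtain ⟨j, rfl⟩ : ∃ j, k = j + 1 := ⟨k - 1, by omega⟩
      have hjl := bb_lt hc (k := j) (by omega)
      have hb := dir_gr hc (k := j) (by omega) hσ ⟨hjl.le, le_rfl⟩
        (ev_left (by exact_mod_cast ha) hjl le_rfl) hv
      have hcop := hv.1
      simp only [hb] at hcop
      rcases coprime_mul hcop with rfl | rfl
      · omega
      · right; left; simp [hb]
    · right; right
      obtain ⟨t, ht, h⟩ := (ev_pos.and (dir_ev hv)).exists
      have ht : (0 : ℝ) < t := ht
      rw [mem_Gam hc] at h
      have h2 : |c (-1) / 2 + (σ : ℝ) * qq g c (bb c k) + t * b - c (-1) / 2|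
          ≤ qq g c (bb c k) := by
        rcases h.2 with h | ⟨-, -, -, h⟩
        · simpa [gr, vr] using h.le
        · simpa [gr, vr] using h
      rw [abs_le] at h2
      have hb := dir_zero hv
      rcases hσ with rfl | rfl <;> rcases hb with rfl | rfl <;> simp at h2 ⊢ <;> linarith
    · have hx := dir_x_right hc ha hv
      rw [← bb_top hc] at hx
      have hk0 := (bb_lt_iff hc (by omega) (by omega)).mp hx
      have hjl := bb_lt hc (k := k) (by omega)
      have hb := dir_gr hc (k := k) (by omega) hσ ⟨le_rfl, hjl.le⟩
        (ev_right (by exact_mod_cast ha) le_rfl hjl) hv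
      have hcop := hv.1
      simp only [hb] at hcop
      rcases coprime_mul hcop with rfl | rfl
      · left; simp [hb, hk0]
      · omega
  · rintro (h | h | h)
    · split_ifs at h with hk'
      · simp at h
        obtain ⟨rfl, rfl⟩ := h
        exact right_mem hc hk' hσ le_rfl (bb_lt hc hk')
      · simp at h
    · split_ifs at h with hk'
      · simp at h
        obtain ⟨rfl, rfl⟩ := h
        obtain ⟨j, rfl⟩ : ∃ j, k = j + 1 := ⟨k - 1, by omega⟩
        have := left_mem hc (k := j) (by omega) hσ (bb_lt hc (by omega)) le_rfl
        push_cast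
        exact this
      · simp at h
    · simp at h
      obtain ⟨rfl, rfl⟩ := h
      exact vert_mem hc hk hσ

/-- directions at an interior point of a rung -/
lemma dirs_rung {g : ℕ} {c : ℤ → ℝ} (hc : Hyp g c) {k : ℕ} (hk : k ≤ g) {y : ℝ}
    (h : |y - c (-1) / 2| < qq g c (bb c k)) :
    localDirs (Gam g c) (bb c k, y) =
      (({(0, 1), (0, -1)} : Finset (ℤ × ℤ)) : Set (ℤ × ℤ)) := by
  ext ⟨a, b⟩
  simp only [Finset.coe_insert, Finset.coe_singleton, Set.mem_insert_iff, Set.mem_singleton_iff,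
    Prod.mk.injEq]
  constructor
  · intro hv
    rcases lt_trichotomy a 0 with ha | rfl | ha
    · exfalso
      have hx := dir_x_left hc ha hv
      have hk0 := (bb_lt_iff hc (by omega) hk).mp hx
      obtain ⟨j, rfl⟩ : ∃ j, k = j + 1 := ⟨k - 1, by omega⟩
      have hjl := bb_lt hc (k := j) (by omega)
      exact h.ne (dir_none hc (k := j) (by omega) ⟨hjl.le, le_rfl⟩
        (ev_left (by exact_mod_cast ha) hjl le_rfl) hv)
    · rcases dir_zero hv with h | h <;> simp [h]
    · exfalso
      have hx := dir_x_right hc ha hv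
      rw [← bb_top hc] at hx
      have hk0 := (bb_lt_iff hc (by omega) (by omega)).mp hx
      have hjl := bb_lt hc (k := k) (by omega)
      exact h.ne (dir_none hc (k := k) (by omega) ⟨le_rfl, hjl.le⟩
        (ev_right (by exact_mod_cast ha) le_rfl hjl) hv)
  · rw [abs_lt] at h
    rintro (⟨rfl, rfl⟩ | ⟨rfl, rfl⟩)
    · exact up_mem hc hk (by linarith) (by linarith)
    · exact down_mem hc hk (by linarith) (by linarith)

/-- every point of `Gam` is of one of three kinds -/
lemma Gam_cases {g : ℕ} {c : ℤ → ℝ} (hc : Hyp g c) {P : ℝ × ℝ} (hP : P ∈ Gam g c) :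
    (∃ k ≤ g, ∃ σ : ℤ, (σ = 1 ∨ σ = -1) ∧ P = gr g c σ (bb c k)) ∨
    (∃ k < g, ∃ σ : ℤ, (σ = 1 ∨ σ = -1) ∧ ∃ x, bb c k < x ∧ x < bb c (k + 1) ∧ P = gr g c σ x) ∨
    (∃ k ≤ g, ∃ y, |y - c (-1) / 2| < qq g c (bb c k) ∧ P = (bb c k, y)) := by
  obtain ⟨x, y⟩ := P
  have hP' := (mem_Gam hc _).mp hP
  obtain ⟨⟨h0, h1⟩, h⟩ := hP'
  simp only at h0 h1 h
  have hsig : |y - c (-1) / 2| = qq g c x → ∃ σ : ℤ, (σ = 1 ∨ σ = -1) ∧ (x, y) = gr g c σ x := by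
    intro h
    rcases abs_sub_eq_cases h with h | h
    · exact ⟨1, Or.inl rfl, by simp [gr, h]⟩
    · exact ⟨-1, Or.inr rfl, by simp [gr, h, sub_eq_add_neg]⟩
  by_cases hb : ∃ k ≤ g, x = bb c k
  · obtain ⟨k, hk, rfl⟩ := hb
    have hle : |y - c (-1) / 2| ≤ qq g c (bb c k) := by
      rcases h with h | ⟨-, -, -, h⟩
      · exact h.le
      · exact h
    rcases hle.lt_or_eq with h | h
    · exact Or.inr (Or.inr ⟨k, hk, y, h, rfl⟩)
    · obtain ⟨σ, hσ, h⟩ := hsig h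
      exact Or.inl ⟨k, hk, σ, hσ, h⟩
  · push Not at hb
    have hne := hb g le_rfl
    rw [bb_top hc] at hne
    obtain ⟨k, hk, h2, h3⟩ := exists_right hc h0 (lt_of_le_of_ne h1 hne)
    have h2' := lt_of_le_of_ne h2 (hb k hk.le).symm
    obtain ⟨σ, hσ, h⟩ := hsig (interior_abs hc hk ⟨h2', h3⟩ hP)
    exact Or.inr (Or.inl ⟨k, hk, σ, hσ, x, h2', h3, h⟩)

lemma localDirs_finite {g : ℕ} {c : ℤ → ℝ} (hc : Hyp g c) (P : ℝ × ℝ) :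
    (localDirs (Gam g c) P).Finite := by
  by_cases hP : P ∈ Gam g c
  · rcases Gam_cases hc hP with ⟨k, hk, σ, hσ, rfl⟩ | ⟨k, hk, σ, hσ, x, h1, h2, rfl⟩ |
      ⟨k, hk, y, hy, rfl⟩
    · rw [dirs_vertex hc hk hσ]
      exact Finset.finite_toSet _
    · rw [dirs_strip hc hk hσ h1 h2]
      exact Finset.finite_toSet _
    · rw [dirs_rung hc hk hy]
      exact Finset.finite_toSet _
  · rw [localDirs_notMem hc hP]
    exact Set.finite_empty

/-! ## Slopes and orders -/

lemma slope_eq {S : Set (ℝ × ℝ)} {f : ℝ × ℝ → ℝ} {P : ℝ × ℝ} {v : ℤ × ℤ} {s : ℤ}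
    (hv : v ∈ localDirs S P) (h : HasSlope S f P v s) : slope S f P v = s := by
  have hex : ∃ s : ℤ, HasSlope S f P v s := ⟨s, h⟩
  unfold TropicalHyperelliptic.slope
  rw [dif_pos hex]
  obtain ⟨ε₁, hε₁, h1⟩ := hex.choose_spec
  obtain ⟨ε₂, hε₂, h2⟩ := h
  obtain ⟨-, ε₃, hε₃, h3⟩ := hv
  obtain ⟨t, ht, ht'⟩ := exists_between (lt_min hε₁ (lt_min hε₂ hε₃))
  simp only [lt_min_iff] at ht'
  have hm := h3 t ht ht'.2.2
  have e1 := h1 t ht.le ht'.1 hm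
  have e2 := h2 t ht.le ht'.2.1 hm
  have e3 : ((hex.choose : ℤ) : ℝ) * t = (s : ℝ) * t := by linarith
  exact_mod_cast mul_right_cancel₀ ht.ne' e3

lemma slope_spec {S : Set (ℝ × ℝ)} {f : ℝ × ℝ → ℝ} (hf : IsRationalFn S f) {P : ℝ × ℝ}
    (hP : P ∈ S) {v : ℤ × ℤ} (hv : v ∈ localDirs S P) : HasSlope S f P v (slope S f P v) := by
  obtain ⟨s, hs⟩ := hf.slope_int P hP v hv
  rw [slope_eq hv hs]
  exact hs

lemma hasSlope_add {S : Set (ℝ × ℝ)} {f h : ℝ × ℝ → ℝ} {P : ℝ × ℝ} {v : ℤ × ℤ} {s s' : ℤ}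
    (h1 : HasSlope S f P v s) (h2 : HasSlope S h P v s') :
    HasSlope S (fun x => f x + h x) P v (s + s') := by
  obtain ⟨ε₁, hε₁, h1⟩ := h1
  obtain ⟨ε₂, hε₂, h2⟩ := h2
  refine ⟨min ε₁ ε₂, lt_min hε₁ hε₂, fun t h0 ht hm => ?_⟩
  rw [lt_min_iff] at ht
  simp only [h1 t h0 ht.1 hm, h2 t h0 ht.2 hm]
  push_cast
  ring

lemma principal_add {g : ℕ} {c : ℤ → ℝ} (hc : Hyp g c) {D D' : Div}
    (h : IsPrincipal (Gam g c) D) (h' : IsPrincipal (Gam g c) D') :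
    IsPrincipal (Gam g c) (D + D') := by
  obtain ⟨f, hf, hD⟩ := h
  obtain ⟨f', hf', hD'⟩ := h'
  refine ⟨fun x => f x + f' x, ⟨hf.cont.add hf'.cont, fun P hP v hv => ?_⟩, fun P => ?_⟩
  · exact ⟨_, hasSlope_add (slope_spec hf hP hv) (slope_spec hf' hP hv)⟩
  · rw [Finsupp.add_apply, hD, hD']
    unfold ord
    rw [← finsum_mem_add_distrib (localDirs_finite hc P)]
    by_cases hP : P ∈ Gam g c
    · apply finsum_mem_congr rfl
      intro v hv
      exact (slope_eq hv (hasSlope_add (slope_spec hf hP hv) (slope_spec hf' hP hv))).symm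
    · rw [localDirs_notMem hc hP]
      simp

lemma principal_zero (g : ℕ) (c : ℤ → ℝ) : IsPrincipal (Gam g c) 0 := by
  have hs : ∀ P v, HasSlope (Gam g c) (fun _ => (0 : ℝ)) P v 0 :=
    fun P v => ⟨1, one_pos, fun t _ _ _ => by simp⟩
  refine ⟨fun _ => 0, ⟨continuousOn_const, fun P _ v _ => ⟨0, hs P v⟩⟩, fun P => ?_⟩
  unfold ord
  rw [Finsupp.zero_apply, eq_comm]
  apply finsum_mem_eq_zero_of_forall_eq_zero
  intro v hv
  exact slope_eq hv (hs P v)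

lemma principal_sum {g : ℕ} {c : ℤ → ℝ} (hc : Hyp g c) {ι : Type*} (s : Finset ι) (D : ι → Div)
    (h : ∀ i ∈ s, IsPrincipal (Gam g c) (D i)) : IsPrincipal (Gam g c) (∑ i ∈ s, D i) := by
  classical
  induction s using Finset.induction_on with
  | empty => simpa using principal_zero g c
  | insert a s ha ih =>
    rw [Finset.sum_insert ha]
    exact principal_add hc (h a (by simp)) (ih fun i hi => h i (by simp [hi]))

lemma ord_strip {g : ℕ} {c : ℤ → ℝ} (hc : Hyp g c) (f : ℝ × ℝ → ℝ) {k : ℕ} (hk : k < g) {σ : ℤ}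
    (hσ : σ = 1 ∨ σ = -1) {x : ℝ} (h1 : bb c k < x) (h2 : x < bb c (k + 1)) :
    ord (Gam g c) f (gr g c σ x) =
      slope (Gam g c) f (gr g c σ x) (1, σ * ((k : ℤ) + 1)) +
      slope (Gam g c) f (gr g c σ x) (-1, -(σ * ((k : ℤ) + 1))) := by
  unfold ord
  rw [dirs_strip hc hk hσ h1 h2, finsum_mem_coe_finset, Finset.sum_pair (by simp)]

lemma ord_rung {g : ℕ} {c : ℤ → ℝ} (hc : Hyp g c) (f : ℝ × ℝ → ℝ) {k : ℕ} (hk : k ≤ g) {y : ℝ}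
    (h : |y - c (-1) / 2| < qq g c (bb c k)) :
    ord (Gam g c) f (bb c k, y) =
      slope (Gam g c) f (bb c k, y) (0, 1) + slope (Gam g c) f (bb c k, y) (0, -1) := by
  unfold ord
  rw [dirs_rung hc hk h, finsum_mem_coe_finset, Finset.sum_pair (by simp)]

lemma ord_vertex {g : ℕ} {c : ℤ → ℝ} (hc : Hyp g c) (f : ℝ × ℝ → ℝ) {k : ℕ} (hk : k ≤ g) {σ : ℤ}
    (hσ : σ = 1 ∨ σ = -1) :
    ord (Gam g c) f (gr g c σ (bb c k)) =
      (if k < g then slope (Gam g c) f (gr g c σ (bb c k)) (1, σ * ((k : ℤ) + 1)) else 0) +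
      ((if 0 < k then slope (Gam g c) f (gr g c σ (bb c k)) (-1, -(σ * (k : ℤ))) else 0) +
      slope (Gam g c) f (gr g c σ (bb c k)) (0, -σ)) := by
  unfold ord
  rw [dirs_vertex hc hk hσ, finsum_mem_coe_finset, Finset.sum_union, Finset.sum_union]
  · congr 1
    · split_ifs <;> simp
    · congr 1
      · split_ifs <;> simp
      · simp
  · split_ifs <;> simp
  · split_ifs <;> simp

/-! ## Evaluation of vertex divisors -/

lemma gr_eq_iff {g : ℕ} {c : ℤ → ℝ} (hc : Hyp g c) {k l : ℕ} (hk : k ≤ g) (hl : l ≤ g)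
    (σ τ : ℤ) : gr g c σ (bb c k) = gr g c τ (bb c l) ↔ σ = τ ∧ k = l := by
  constructor
  · intro h
    simp only [gr, Prod.mk.injEq] at h
    obtain rfl := bb_inj hc hk hl h.1
    have hq := qq_pos hc (bb c k)
    have h2 : (σ : ℝ) * qq g c (bb c k) = τ * qq g c (bb c k) := by linarith [h.2]
    exact ⟨by exact_mod_cast mul_right_cancel₀ hq.ne' h2, rfl⟩
  · rintro ⟨rfl, rfl⟩
    rfl

lemma single_gr {g : ℕ} {c : ℤ → ℝ} (hc : Hyp g c) {k l : ℕ} (hk : k ≤ g) (hl : l ≤ g)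
    (σ τ : ℤ) : (Finsupp.single (gr g c σ (bb c k)) (1 : ℤ)) (gr g c τ (bb c l)) =
      if σ = τ ∧ k = l then 1 else 0 := by
  classical
  rw [Finsupp.single_apply]
  exact if_congr (gr_eq_iff hc hk hl σ τ) rfl rfl

lemma strip_ne {g : ℕ} {c : ℤ → ℝ} (hc : Hyp g c) {k l : ℕ} (hk : k ≤ g) (hl : l < g)
    {x : ℝ} (h1 : bb c l < x) (h2 : x < bb c (l + 1)) : x ≠ bb c k := by
  rintro rfl
  have h1 := (bb_lt_iff hc (by omega) (by omega)).mp h1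
  have h2 := (bb_lt_iff hc (by omega) (by omega)).mp h2
  omega

lemma single_gr_strip {g : ℕ} {c : ℤ → ℝ} (hc : Hyp g c) {k l : ℕ} (hk : k ≤ g) (hl : l < g)
    (σ τ : ℤ) {x : ℝ} (h1 : bb c l < x) (h2 : x < bb c (l + 1)) :
    (Finsupp.single (gr g c σ (bb c k)) (1 : ℤ)) (gr g c τ x) = 0 := by
  apply Finsupp.single_eq_of_ne
  intro h
  exact strip_ne hc hk hl h1 h2 (congrArg Prod.fst h)

lemma single_gr_rung {g : ℕ} {c : ℤ → ℝ} (hc : Hyp g c) {k l : ℕ} (hk : k ≤ g) (hl : l ≤ g)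
    {σ : ℤ} (hσ : σ = 1 ∨ σ = -1) {y : ℝ} (h : |y - c (-1) / 2| < qq g c (bb c l)) :
    (Finsupp.single (gr g c σ (bb c k)) (1 : ℤ)) (bb c l, y) = 0 := by
  apply Finsupp.single_eq_of_ne
  intro h'
  have e := h'
  simp only [gr, Prod.mk.injEq] at e
  obtain rfl := bb_inj hc hl hk e.1
  have hq := qq_pos hc (bb c l)
  rw [e.2] at h
  rcases hσ with rfl | rfl <;> simp [abs_of_pos hq] at h

lemma single_gr_notMem {g : ℕ} {c : ℤ → ℝ} (hc : Hyp g c) {k : ℕ} (hk : k ≤ g)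
    {σ : ℤ} (hσ : σ = 1 ∨ σ = -1) {P : ℝ × ℝ} (h : P ∉ Gam g c) :
    (Finsupp.single (gr g c σ (bb c k)) (1 : ℤ)) P = 0 := by
  apply Finsupp.single_eq_of_ne
  rintro rfl
  apply h
  refine gr_mem hc hσ (bb_le hc (by omega) hk) ?_
  rw [← bb_top hc]
  exact bb_le hc hk le_rfl

/-! ## Principal divisors supported on vertices -/

lemma max_slope (S : Set (ℝ × ℝ)) (b : ℝ) (P : ℝ × ℝ) (v : ℤ × ℤ) :
    HasSlope S (fun P => max P.1 b) P v
      (if b < P.1 then v.1 else if P.1 < b then 0 else max v.1 0) := by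
  obtain ⟨x, y⟩ := P
  obtain ⟨a, b'⟩ := v
  have hA : 0 < |(a : ℝ)| + 1 := by positivity
  have hbd : ∀ t : ℝ, 0 ≤ t → ∀ δ : ℝ, t < δ / (|(a : ℝ)| + 1) → |t * a| < δ ∨ t * a = 0 := by
    intro t h0 δ ht
    rw [lt_div_iff₀ hA] at ht
    left
    rw [abs_mul, abs_of_nonneg h0]
    linarith
  rcases lt_trichotomy b x with h | rfl | h
  · refine ⟨(x - b) / (|(a : ℝ)| + 1), div_pos (by linarith) hA, fun t h0 ht _ => ?_⟩
    have : b < x + t * a := by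
      rcases hbd t h0 _ ht with h | h
      · have := (abs_lt.mp h).1
        linarith
      · linarith
    simp [vr, h]
    rw [max_eq_left this.le, max_eq_left h.le]
    ring
  · refine ⟨1, one_pos, fun t h0 _ _ => ?_⟩
    simp [vr]
    rcases le_total 0 (a : ℝ) with h | h
    · have := mul_nonneg h0 h
      rw [max_eq_left h, max_eq_left (by linarith)]
      ring
    · have := mul_nonneg h0 (neg_nonneg.mpr h)
      rw [max_eq_right h, max_eq_right (by linarith)]
      ring
  · refine ⟨(b - x) / (|(a : ℝ)| + 1), div_pos (by linarith) hA, fun t h0 ht _ => ?_⟩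
    have : x + t * a < b := by
      rcases hbd t h0 _ ht with h | h
      · have := (abs_lt.mp h).2
        linarith
      · linarith
    simp [vr, h, h.not_gt]
    rw [max_eq_right this.le, max_eq_right h.le]

lemma pair_principal {g : ℕ} {c : ℤ → ℝ} (hc : Hyp g c) {k : ℕ} (hk : k < g) :
    IsPrincipal (Gam g c)
      ((Finsupp.single (gr g c 1 (bb c k)) (1 : ℤ) + Finsupp.single (gr g c (-1) (bb c k)) (1 : ℤ))
      - (Finsupp.single (gr g c 1 (bb c g)) (1 : ℤ)
        + Finsupp.single (gr g c (-1) (bb c g)) (1 : ℤ))) := by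
  have hsl := fun P v => max_slope (Gam g c) (bb c k) P v
  refine ⟨fun P => max P.1 (bb c k), ⟨by fun_prop, fun P _ v _ => ⟨_, hsl P v⟩⟩, fun P => ?_⟩
  simp only [Finsupp.sub_apply, Finsupp.add_apply]
  by_cases hP : P ∈ Gam g c
  · rcases Gam_cases hc hP with ⟨l, hl, σ, hσ, rfl⟩ | ⟨l, hl, σ, hσ, x, h1, h2, rfl⟩ |
      ⟨l, hl, y, hy, rfl⟩
    · have hx : (gr g c σ (bb c l)).1 = bb c l := rfl
      rw [ord_vertex hc _ hl hσ, slope_eq (vert_mem hc hl hσ) (hsl _ _)]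
      have e1 : (if l < g then slope (Gam g c) (fun P => max P.1 (bb c k)) (gr g c σ (bb c l))
          (1, σ * ((l : ℤ) + 1)) else 0) = if l < g ∧ k ≤ l then 1 else 0 := by
        by_cases h : l < g
        · rw [if_pos h, slope_eq (right_mem hc h hσ le_rfl (bb_lt hc h)) (hsl _ _)]
          simp only [hx, bb_lt_iff hc hk.le hl, bb_lt_iff hc hl hk.le]
          split_ifs <;> omega
        · simp [h]
      have e2 : (if 0 < l then slope (Gam g c) (fun P => max P.1 (bb c k)) (gr g c σ (bb c l))
          (-1, -(σ * (l : ℤ))) else 0) = if k < l then -1 else 0 := by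
        by_cases h : 0 < l
        · obtain ⟨j, rfl⟩ : ∃ j, l = j + 1 := ⟨l - 1, by omega⟩
          have := left_mem hc (k := j) (by omega) hσ (bb_lt hc (by omega)) le_rfl
          push_cast
          rw [if_pos h, slope_eq this (hsl _ _)]
          simp only [hx, bb_lt_iff hc hk.le hl, bb_lt_iff hc hl hk.le]
          split_ifs <;> omega
        · rw [if_neg h, if_neg (by omega)]
      rw [e1, e2]
      simp only [single_gr hc hk.le hl, single_gr hc le_rfl hl]
      rcases hσ with rfl | rfl <;> simp <;> split_ifs <;> omega
    · rw [ord_strip hc _ hl hσ h1 h2, slope_eq (right_mem hc hl hσ h1.le h2) (hsl _ _),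
        slope_eq (left_mem hc hl hσ h1 h2.le) (hsl _ _)]
      simp only [single_gr_strip hc hk.le hl _ _ h1 h2, single_gr_strip hc le_rfl hl _ _ h1 h2]
      have : (gr g c σ x).1 = x := rfl
      have := strip_ne hc hk.le hl h1 h2
      split_ifs with h3 h4
      · simp
      · simp
      · exact absurd (le_antisymm (not_lt.mp h3) (not_lt.mp h4)) this
    · have hy' := abs_lt.mp hy
      rw [ord_rung hc _ hl hy, slope_eq (up_mem hc hl (by linarith) (by linarith)) (hsl _ _),
        slope_eq (down_mem hc hl (by linarith) (by linarith)) (hsl _ _)]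
      simp [single_gr_rung hc hk.le hl (Or.inl rfl) hy, single_gr_rung hc hk.le hl (Or.inr rfl) hy,
        single_gr_rung hc le_rfl hl (Or.inl rfl) hy, single_gr_rung hc le_rfl hl (Or.inr rfl) hy]
  · simp [single_gr_notMem hc hk.le (Or.inl rfl) hP, single_gr_notMem hc hk.le (Or.inr rfl) hP,
      single_gr_notMem hc le_rfl (Or.inl rfl) hP, single_gr_notMem hc le_rfl (Or.inr rfl) hP,
      ord, localDirs_notMem hc hP]

/-! ## Vertices -/

lemma V_eq {g : ℕ} {c : ℤ → ℝ} (hc : Hyp g c) {k : ℕ} (hk : k ≤ g) :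
    V g c (g - k) = gr g c 1 (bb c k) := by
  have hp := pt_bb hc hk
  have e : (g : ℤ) - ((g - k : ℕ) : ℤ) = k := by push_cast [Nat.cast_sub hk]; ring
  ext
  · simp only [V, gr, e, bb]
  · simp only [V, gr, e, qq, hp]
    simp only [bb]
    push_cast
    ring

lemma conjV_eq {g : ℕ} {c : ℤ → ℝ} (hc : Hyp g c) {k : ℕ} (hk : k ≤ g) :
    conj c (V g c (g - k)) = gr g c (-1) (bb c k) := by
  rw [V_eq hc hk]
  ext
  · simp [conj, gr]
  · simp [conj, gr]
    ring

lemma V0_eq {g : ℕ} {c : ℤ → ℝ} (hc : Hyp g c) : V g c 0 = gr g c 1 (bb c g) := by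
  simpa using V_eq hc (k := g) le_rfl

lemma conjV0_eq {g : ℕ} {c : ℤ → ℝ} (hc : Hyp g c) :
    conj c (V g c 0) = gr g c (-1) (bb c g) := by
  simpa using conjV_eq hc (k := g) le_rfl

/-- the pair of vertices on rung `k` -/
noncomputable def pairDiv (g : ℕ) (c : ℤ → ℝ) (k : ℕ) : Div :=
  Finsupp.single (gr g c 1 (bb c k)) (1 : ℤ) + Finsupp.single (gr g c (-1) (bb c k)) (1 : ℤ)

lemma Odiv_eq {m : ℕ} {c : ℤ → ℝ} (hc : Hyp (2 * m + 1) c) :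
    OdivOdd (2 * m + 1) c = Finsupp.single (gr (2 * m + 1) c 1 (bb c (2 * m + 1))) (1 : ℤ)
      + ∑ j ∈ Finset.range m, pairDiv (2 * m + 1) c (2 * j + 1) := by
  unfold OdivOdd
  have hm : (2 * m + 1 - 1) / 2 = m := by omega
  rw [V0_eq hc, hm]
  congr 1
  rw [← Finset.sum_range_reflect, Finset.sum_range]
  apply Finset.sum_congr rfl
  intro j _
  have hj := j.2
  have e : 2 * (j : ℕ) + 2 = 2 * m + 1 - (2 * (m - 1 - (j : ℕ)) + 1) := by omega
  rw [e, conjV_eq hc (by omega), V_eq hc (by omega), pairDiv]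

lemma Dstar_eq {m : ℕ} {c : ℤ → ℝ} (hc : Hyp (2 * m + 1) c) :
    DstarOdd (2 * m + 1) c = (m : ℤ) • pairDiv (2 * m + 1) c (2 * m + 1) +
      Finsupp.single (gr (2 * m + 1) c 1 (bb c (2 * m + 1))) (1 : ℤ) := by
  unfold DstarOdd
  have hm : (2 * m + 1 - 1) / 2 = m := by omega
  rw [conjV0_eq hc, V0_eq hc, hm]
  rfl

lemma O_principal {m : ℕ} {c : ℤ → ℝ} (hc : Hyp (2 * m + 1) c) :
    IsPrincipal (Gam (2 * m + 1) c) (OdivOdd (2 * m + 1) c - DstarOdd (2 * m + 1) c) := by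
  have : OdivOdd (2 * m + 1) c - DstarOdd (2 * m + 1) c = ∑ j ∈ Finset.range m,
      (pairDiv (2 * m + 1) c (2 * j + 1) - pairDiv (2 * m + 1) c (2 * m + 1)) := by
    rw [Odiv_eq hc, Dstar_eq hc, Finset.sum_sub_distrib, Finset.sum_const, Finset.card_range,
      natCast_zsmul]
    abel
  rw [this]
  apply principal_sum hc
  intro j hj
  exact pair_principal hc (by have := Finset.mem_range.mp hj; omega)

/-! ## Piecewise linear functions on an interval -/

/-- outgoing slope to the right -/
def HasRS (u : ℝ → ℝ) (x : ℝ) (s : ℤ) : Prop :=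
  ∃ ε > (0 : ℝ), ∀ t : ℝ, 0 ≤ t → t < ε → u (x + t) = u x + s * t

/-- outgoing slope to the left -/
def HasLS (u : ℝ → ℝ) (x : ℝ) (s : ℤ) : Prop :=
  ∃ ε > (0 : ℝ), ∀ t : ℝ, 0 ≤ t → t < ε → u (x - t) = u x + s * t

lemma HasRS.sub {u v : ℝ → ℝ} {x : ℝ} {s s' : ℤ} (h1 : HasRS u x s) (h2 : HasRS v x s') :
    HasRS (fun x => u x - v x) x (s - s') := by
  obtain ⟨ε₁, hε₁, h1⟩ := h1
  obtain ⟨ε₂, hε₂, h2⟩ := h2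
  refine ⟨min ε₁ ε₂, lt_min hε₁ hε₂, fun t h0 ht => ?_⟩
  rw [lt_min_iff] at ht
  simp only [h1 t h0 ht.1, h2 t h0 ht.2]
  push_cast
  ring

lemma HasLS.sub {u v : ℝ → ℝ} {x : ℝ} {s s' : ℤ} (h1 : HasLS u x s) (h2 : HasLS v x s') :
    HasLS (fun x => u x - v x) x (s - s') := by
  obtain ⟨ε₁, hε₁, h1⟩ := h1
  obtain ⟨ε₂, hε₂, h2⟩ := h2
  refine ⟨min ε₁ ε₂, lt_min hε₁ hε₂, fun t h0 ht => ?_⟩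
  rw [lt_min_iff] at ht
  simp only [h1 t h0 ht.1, h2 t h0 ht.2]
  push_cast
  ring

lemma affine_aux {F : ℝ → ℝ} {a b : ℝ} (hab : a < b) (hF : ContinuousOn F (Set.Icc a b))
    (h : ∀ x ∈ Set.Ioo a b, ∃ s s' : ℤ, HasRS F x s ∧ HasLS F x s' ∧ s + s' = 0) :
    ∃ s : ℝ, ∀ x ∈ Set.Icc a b, F x = F a + s * (x - a) := by
  have key : ∀ x ∈ Set.Ioo a b, ∃ s : ℝ, F =ᶠ[nhds x] fun z => F x + s * (z - x) := by
    intro x hx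
    obtain ⟨s, s', ⟨ε₁, hε₁, h1⟩, ⟨ε₂, hε₂, h2⟩, hs⟩ := h x hx
    refine ⟨s, ?_⟩
    filter_upwards [Ioo_mem_nhds (show x - ε₂ < x by linarith) (show x < x + ε₁ by linarith)]
      with z hz
    rcases le_total x z with hxz | hxz
    · have := h1 (z - x) (by linarith) (by linarith [hz.2])
      rw [show x + (z - x) = z by ring] at this
      exact this
    · have := h2 (x - z) (by linarith) (by linarith [hz.1])
      rw [show x - (x - z) = z by ring] at this
      rw [this]
      have : (s : ℝ) + s' = 0 := by exact_mod_cast hs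
      have : (s' : ℝ) = -s := by linarith
      rw [this]
      ring
  have hlin : ∀ s x C : ℝ, HasDerivAt (fun z : ℝ => C + s * (z - x)) s x := by
    intro s x C
    simpa using (((hasDerivAt_id x).sub_const x).const_mul s).const_add C
  have hlin' : ∀ s x C z' : ℝ, HasDerivAt (fun z : ℝ => C + s * (z - x)) s z' := by
    intro s x C z'
    simpa using (((hasDerivAt_id z').sub_const x).const_mul s).const_add C
  have hd : ∀ x ∈ Set.Ioo a b, DifferentiableAt ℝ F x := by
    intro x hx
    obtain ⟨s, hs⟩ := key x hx
    exact ((hlin s x _).congr_of_eventuallyEq hs).differentiableAt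
  have hdd : ∀ x ∈ Set.Ioo a b, HasDerivAt (deriv F) 0 x := by
    intro x hx
    obtain ⟨s, hs⟩ := key x hx
    have : deriv F =ᶠ[nhds x] fun _ => s := by
      filter_upwards [hs.eventuallyEq_nhds] with z hz
      rw [hz.deriv_eq]
      exact (hlin' s x _ z).deriv
    exact (hasDerivAt_const x s).congr_of_eventuallyEq this
  obtain ⟨s, hs⟩ := isOpen_Ioo.exists_is_const_of_deriv_eq_zero (isPreconnected_Ioo)
    (f := deriv F) (s := Set.Ioo a b)
    (fun x hx => (hdd x hx).differentiableAt.differentiableWithinAt)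
    (fun x hx => (hdd x hx).deriv)
  refine ⟨s, fun x hx => ?_⟩
  rcases hx.1.eq_or_lt with rfl | hax
  · simp
  · obtain ⟨z, hz, hz'⟩ := exists_hasDerivAt_eq_slope F (deriv F) hax
      (hF.mono (Set.Icc_subset_Icc_right hx.2))
      (fun z hz => (hd z ⟨hz.1, hz.2.trans_le hx.2⟩).hasDerivAt)
    rw [hs z ⟨hz.1, hz.2.trans_le hx.2⟩] at hz'
    have : x - a ≠ 0 := by linarith
    field_simp at hz'
    linarith

lemma affine_seg {F : ℝ → ℝ} {a b : ℝ} (hab : a < b) (hF : ContinuousOn F (Set.Icc a b))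
    (h : ∀ x ∈ Set.Ioo a b, ∃ s s' : ℤ, HasRS F x s ∧ HasLS F x s' ∧ s + s' = 0)
    {s s' : ℤ} (ha : HasRS F a s) (hb : HasLS F b s') :
    F b - F a = s * (b - a) ∧ s + s' = 0 := by
  obtain ⟨m, hm⟩ := affine_aux hab hF h
  obtain ⟨ε₁, hε₁, h1⟩ := ha
  obtain ⟨ε₂, hε₂, h2⟩ := hb
  obtain ⟨t, ht, ht'⟩ := exists_between (lt_min (sub_pos.mpr hab) (lt_min hε₁ hε₂))
  simp only [lt_min_iff] at ht'
  have e1 := h1 t ht.le ht'.2.1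
  rw [hm (a + t) ⟨by linarith, by linarith⟩] at e1
  have e2 := h2 t ht.le ht'.2.2
  rw [hm (b - t) ⟨by linarith, by linarith⟩, hm b ⟨hab.le, le_rfl⟩] at e2
  have m1 : m = s := mul_right_cancel₀ ht.ne' (by linarith)
  have m2 : (s' : ℝ) = -m := mul_right_cancel₀ ht.ne' (by linarith)
  constructor
  · rw [hm b ⟨hab.le, le_rfl⟩, m1]
    ring
  · have : (s : ℝ) + s' = 0 := by rw [m2, m1]; ring
    exact_mod_cast this

/-- the edge lemma: at most one zero or pole in the interior of the edge -/
lemma edge_lemma {F : ℝ → ℝ} {a b : ℝ} (hab : a < b) (hF : ContinuousOn F (Set.Icc a b))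
    (n : ℝ → ℤ) (N : ℤ)
    (h : ∀ x ∈ Set.Ioo a b, ∃ s s' : ℤ, HasRS F x s ∧ HasLS F x s' ∧ s + s' = n x)
    (hn : ((∀ x ∈ Set.Ioo a b, n x = 0) ∧ N = 0) ∨
      ∃ τ ∈ Set.Ioo a b, n τ = N ∧ ∀ x ∈ Set.Ioo a b, x ≠ τ → n x = 0)
    {s s' : ℤ} (ha : HasRS F a s) (hb : HasLS F b s') :
    (∃ α > (0 : ℝ), ∃ β > (0 : ℝ), F b - F a = s * α + ((-s' : ℤ) : ℝ) * β) ∧ -s' = s + N := by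
  rcases hn with ⟨hn, rfl⟩ | ⟨τ, hτ, hN, hn⟩
  · obtain ⟨e1, e2⟩ := affine_seg hab hF (fun x hx => by rw [← hn x hx]; exact h x hx) ha hb
    refine ⟨⟨(b - a) / 2, by linarith, (b - a) / 2, by linarith, ?_⟩, by omega⟩
    rw [show -s' = s by omega, e1]
    ring
  · obtain ⟨r, r', hr, hr', hrr⟩ := h τ hτ
    obtain ⟨e1, e2⟩ := affine_seg hτ.1 (hF.mono (Set.Icc_subset_Icc_right hτ.2.le))
      (fun x hx => by
        rw [← hn x ⟨hx.1, hx.2.trans hτ.2⟩ hx.2.ne]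
        exact h x ⟨hx.1, hx.2.trans hτ.2⟩) ha hr'
    obtain ⟨e3, e4⟩ := affine_seg hτ.2 (hF.mono (Set.Icc_subset_Icc_left hτ.1.le))
      (fun x hx => by
        rw [← hn x ⟨hτ.1.trans hx.1, hx.2⟩ hx.1.ne']
        exact h x ⟨hτ.1.trans hx.1, hx.2⟩) hr hb
    refine ⟨⟨τ - a, by linarith [hτ.1], b - τ, by linarith [hτ.2], ?_⟩, by omega⟩
    rw [show -s' = r by omega]
    linarith

/-! ## The combinatorial argument -/

lemma comb_pos {α β w : ℝ} {s t ι : ℤ} (hα : 0 < α) (hβ : 0 < β)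
    (hw : w = s * α + t * β) (ht : t = s + ι) (hι : 0 ≤ ι) (h : 0 < w) : 1 ≤ t := by
  by_contra hcon
  have h1 : (t : ℝ) ≤ 0 := by exact_mod_cast (by omega : t ≤ 0)
  have h2 : (s : ℝ) ≤ 0 := by exact_mod_cast (by omega : s ≤ 0)
  nlinarith

lemma comb_neg {α β w : ℝ} {s t ι : ℤ} (hα : 0 < α) (hβ : 0 < β)
    (hw : w = s * α + t * β) (ht : t = s + ι) (hι : 0 ≤ ι) (h : w < 0) : s ≤ -1 := by
  by_contra hcon
  have h1 : 0 ≤ (t : ℝ) := by exact_mod_cast (by omega : 0 ≤ t)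
  have h2 : 0 ≤ (s : ℝ) := by exact_mod_cast (by omega : 0 ≤ s)
  nlinarith

lemma comb_zero {α β w : ℝ} {s t ι : ℤ} (hα : 0 < α) (hβ : 0 < β)
    (hw : w = s * α + t * β) (ht : t = s + ι) (hι : 0 ≤ ι) (hι1 : ι ≤ 1) (h : w = 0) :
    s = 0 ∧ t = 0 := by
  rcases lt_trichotomy s 0 with hs | hs | hs
  · exfalso
    have h1 : (t : ℝ) ≤ 0 := by exact_mod_cast (by omega : t ≤ 0)
    have h2 : (s : ℝ) < 0 := by exact_mod_cast hs
    nlinarith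
  · refine ⟨hs, ?_⟩
    subst hs
    rw [h] at hw
    have : (t : ℝ) * β = 0 := by
      push_cast at hw
      linarith
    rcases mul_eq_zero.mp this with h | h
    · exact_mod_cast h
    · linarith
  · exfalso
    have h1 : 0 < (t : ℝ) := by exact_mod_cast (by omega : 0 < t)
    have h2 : 0 < (s : ℝ) := by exact_mod_cast hs
    nlinarith

lemma comb_mono {α β w : ℝ} {s t : ℤ} (hα : 0 < α) (hβ : 0 < β)
    (hw : w = s * α + t * β) (hs : 0 ≤ s) (ht : 0 ≤ t) (hst : 1 ≤ s + t) : 0 < w := by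
  have h1 : 0 ≤ (t : ℝ) := by exact_mod_cast ht
  have h2 : 0 ≤ (s : ℝ) := by exact_mod_cast hs
  rcases hs.lt_or_eq with h | h
  · have h3 : 0 < (s : ℝ) := by exact_mod_cast h
    have := mul_pos h3 hα
    have := mul_nonneg h1 hβ.le
    linarith
  · have h3 : 0 < (t : ℝ) := by exact_mod_cast (by omega : 0 < t)
    have := mul_pos h3 hβ
    have := mul_nonneg h2 hα.le
    linarith

lemma comb_anti {α β w : ℝ} {s t : ℤ} (hα : 0 < α) (hβ : 0 < β)
    (hw : w = s * α + t * β) (hs : s ≤ 0) (ht : t ≤ 0) (hst : s + t ≤ -1) : w < 0 := by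
  have := comb_mono (w := -w) (s := -s) (t := -t) hα hβ (by push_cast; linarith)
    (by omega) (by omega) (by omega)
  linarith

/-- One step from rung `k` (with its invariant) to rung `k+1`. -/
lemma comb_step {w w' α β α' β' : ℝ} {d0 d1 sb st tL bL oL tR bR oR up dn d0' : ℤ}
    (hα : 0 < α) (hβ : 0 < β) (hα' : 0 < α') (hβ' : 0 < β')
    (hw : w' - w = d0 * α + d1 * β) (hd : d1 = d0 + (up - dn))
    (hw' : w' = sb * α' + st * β') (hst : st = sb + (oR + oL))
    (hd' : d0' = d1 + sb + st + (tR + tL) - (bR + bL))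
    (htR : 0 ≤ tR) (hbR : 0 ≤ bR) (hoR : 0 ≤ oR) (hup : 0 ≤ up) (hdn : 0 ≤ dn)
    (htL : 0 ≤ tL) (hbL : 0 ≤ bL) (hoL : 0 ≤ oL)
    (hR : tR + bR + oR + up + dn ≤ 1) (ho : oR + oL ≤ 1)
    (hinv : (w = 0 ∧ d0 = 0) ∨ (0 ≤ w ∧ 1 ≤ d0) ∨ (w ≤ 0 ∧ d0 ≤ -1)) :
    (w = 0 ∧ d0 = 0 ∧ w' = 0 ∧ up = 0 ∧ dn = 0 ∧ oR = 0 ∧ oL = 0 ∧ d0' = (tR + tL) - (bR + bL)) ∨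
    (0 ≤ w' ∧ 2 - (tL + bL + oL) ≤ d0') ∨ (w' ≤ 0 ∧ d0' ≤ -2 + (tL + bL + oL)) := by
  have posC : 0 < w' → 0 ≤ d1 → 1 ≤ d1 + dn → 2 - (tL + bL + oL) ≤ d0' := by
    intro h1 h2 h3
    have := comb_pos hα' hβ' hw' hst (by omega) h1
    omega
  have negC : w' < 0 → d1 ≤ 0 → d1 - up ≤ -1 → d0' ≤ -2 + (tL + bL + oL) := by
    intro h1 h2 h3
    have := comb_neg hα' hβ' hw' hst (by omega) h1
    omega
  rcases hinv with ⟨h1, h2⟩ | ⟨h1, h2⟩ | ⟨h1, h2⟩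
  · rcases lt_trichotomy d1 0 with h | h | h
    · have := comb_anti hα hβ hw (by omega) (by omega) (by omega)
      exact Or.inr (Or.inr ⟨by linarith, negC (by linarith) (by omega) (by omega)⟩)
    · left
      have hw0 : w' = 0 := by
        rw [h, h2, h1] at hw
        simpa using hw
      have := comb_zero hα' hβ' hw' hst (by omega) ho hw0
      refine ⟨h1, h2, hw0, ?_, ?_, ?_, ?_, ?_⟩ <;> omega
    · have := comb_mono hα hβ hw (by omega) (by omega) (by omega)
      exact Or.inr (Or.inl ⟨by linarith, posC (by linarith) (by omega) (by omega)⟩)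
  · have := comb_mono hα hβ hw (by omega) (by omega) (by omega)
    exact Or.inr (Or.inl ⟨by linarith, posC (by linarith) (by omega) (by omega)⟩)
  · have := comb_anti hα hβ hw (by omega) (by omega) (by omega)
    exact Or.inr (Or.inr ⟨by linarith, negC (by linarith) (by omega) (by omega)⟩)

lemma comb_main (m : ℕ) (w : ℕ → ℝ) (d0 d1 sb st tL bL oL tR bR oR up dn : ℕ → ℤ)
    (hstrip : ∀ j < 2 * m + 1, (∃ α > (0 : ℝ), ∃ β > (0 : ℝ),
      w (j + 1) - w j = d0 j * α + d1 j * β) ∧ d1 j = d0 j + (up j - dn j))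
    (hrung : ∀ k ≤ 2 * m + 1, ∃ α > (0 : ℝ), ∃ β > (0 : ℝ), w k = sb k * α + st k * β)
    (hst0 : st 0 = sb 0 + oL 0)
    (hst : ∀ k < 2 * m + 1, st (k + 1) = sb (k + 1) + (oR k + oL (k + 1)))
    (hd0 : d0 0 = sb 0 + st 0 + tL 0 - bL 0)
    (hd : ∀ k < 2 * m + 1,
      d0 (k + 1) = d1 k + sb (k + 1) + st (k + 1) + (tR k + tL (k + 1)) - (bR k + bL (k + 1)))
    (hdg : d0 (2 * m + 1) = 1)
    (hnn : ∀ j, 0 ≤ tL j ∧ 0 ≤ bL j ∧ 0 ≤ oL j ∧ 0 ≤ tR j ∧ 0 ≤ bR j ∧ 0 ≤ oR j ∧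
      0 ≤ up j ∧ 0 ≤ dn j)
    (hsum : ∀ j < 2 * m + 1, tL j + bL j + oL j + tR j + bR j + oR j + up j + dn j = 1)
    (hLg : tL (2 * m + 1) + bL (2 * m + 1) + oL (2 * m + 1) = 0)
    (ho : ∀ k < 2 * m + 1, oR k + oL (k + 1) ≤ 1) :
    (∀ i < m, tR (2 * i) + bR (2 * i) = 1 ∧ tL (2 * i + 1) = bR (2 * i) ∧
      bL (2 * i + 1) = tR (2 * i)) ∧ tR (2 * m) = 1 := by
  have hstep : ∀ k < 2 * m + 1,
      ((w k = 0 ∧ d0 k = 0) ∨ (0 ≤ w k ∧ 1 ≤ d0 k) ∨ (w k ≤ 0 ∧ d0 k ≤ -1)) →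
      (w k = 0 ∧ d0 k = 0 ∧ w (k + 1) = 0 ∧ up k = 0 ∧ dn k = 0 ∧ oR k = 0 ∧ oL (k + 1) = 0 ∧
        d0 (k + 1) = (tR k + tL (k + 1)) - (bR k + bL (k + 1))) ∨
      (0 ≤ w (k + 1) ∧ 2 - (tL (k + 1) + bL (k + 1) + oL (k + 1)) ≤ d0 (k + 1)) ∨
      (w (k + 1) ≤ 0 ∧ d0 (k + 1) ≤ -2 + (tL (k + 1) + bL (k + 1) + oL (k + 1))) := by
    intro k hk hinv
    obtain ⟨⟨α, hα, β, hβ, hw⟩, hdd⟩ := hstrip k hk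
    obtain ⟨α', hα', β', hβ', hw'⟩ := hrung (k + 1) (by omega)
    obtain ⟨a1, a2, a3, a4, a5, a6, a7, a8⟩ := hnn k
    obtain ⟨b1, b2, b3, -⟩ := hnn (k + 1)
    have := hsum k hk
    exact comb_step hα hβ hα' hβ' hw hdd hw' (hst k hk) (hd k hk) a4 a5 a6 a7 a8 b1 b2 b3
      (by omega) (ho k hk) hinv
  have hL1 : ∀ k ≤ 2 * m + 1, tL k + bL k + oL k ≤ 1 := by
    intro k hk
    rcases hk.lt_or_eq with h | rfl
    · have := hsum k h
      have := hnn k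
      omega
    · omega
  have hinv0 : ((w 0 = 0 ∧ d0 0 = 0) ∨ (0 ≤ w 0 ∧ 1 ≤ d0 0) ∨ (w 0 ≤ 0 ∧ d0 0 ≤ -1)) ∧
      (w 0 = 0 → oL 0 = 0 ∧ d0 0 = tL 0 - bL 0) := by
    obtain ⟨α', hα', β', hβ', hw'⟩ := hrung 0 (by omega)
    have h1 := hL1 0 (by omega)
    have h2 := hnn 0
    rcases lt_trichotomy (w 0) 0 with h | h | h
    · have := comb_neg hα' hβ' hw' hst0 (by omega) h
      exact ⟨Or.inr (Or.inr ⟨h.le, by omega⟩), fun h' => absurd h' h.ne⟩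
    · have := comb_zero hα' hβ' hw' hst0 (by omega) (by omega) h
      have e : oL 0 = 0 ∧ d0 0 = tL 0 - bL 0 := ⟨by omega, by omega⟩
      refine ⟨?_, fun _ => e⟩
      rcases lt_trichotomy (d0 0) 0 with h' | h' | h'
      · exact Or.inr (Or.inr ⟨h.le, by omega⟩)
      · exact Or.inl ⟨h, h'⟩
      · exact Or.inr (Or.inl ⟨h.ge, by omega⟩)
    · have := comb_pos hα' hβ' hw' hst0 (by omega) h
      exact ⟨Or.inr (Or.inl ⟨h.le, by omega⟩), fun h' => absurd h' h.ne'⟩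
  have hinv : ∀ k ≤ 2 * m + 1,
      (w k = 0 ∧ d0 k = 0) ∨ (0 ≤ w k ∧ 1 ≤ d0 k) ∨ (w k ≤ 0 ∧ d0 k ≤ -1) := by
    intro k
    induction k with
    | zero => intro _; exact hinv0.1
    | succ k ih =>
      intro hk
      have h1 := hL1 (k + 1) hk
      rcases hstep k (by omega) (ih (by omega)) with ⟨-, -, h2, -⟩ | ⟨h2, h3⟩ | ⟨h2, h3⟩
      · rcases lt_trichotomy (d0 (k + 1)) 0 with h' | h' | h'
        · exact Or.inr (Or.inr ⟨h2.le, by omega⟩)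
        · exact Or.inl ⟨h2, h'⟩
        · exact Or.inr (Or.inl ⟨h2.ge, by omega⟩)
      · exact Or.inr (Or.inl ⟨h2, by omega⟩)
      · exact Or.inr (Or.inr ⟨h2, by omega⟩)
  -- once nonzero, always nonzero
  have hback : ∀ k < 2 * m + 1, (w (k + 1) = 0 ∧ d0 (k + 1) = 0) → (w k = 0 ∧ d0 k = 0) := by
    intro k hk h
    rcases hstep k hk (hinv k (by omega)) with h2 | h2 | h2
    · exact ⟨h2.1, h2.2.1⟩
    · have := hL1 (k + 1) (by omega)
      omega
    · have := hL1 (k + 1) (by omega)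
      omega
  have hlast : w (2 * m) = 0 ∧ d0 (2 * m) = 0 := by
    rcases hstep (2 * m) (by omega) (hinv (2 * m) (by omega)) with h2 | h2 | h2
    · exact ⟨h2.1, h2.2.1⟩
    · omega
    · omega
  have hZ : ∀ i, i ≤ 2 * m → (w (2 * m - i) = 0 ∧ d0 (2 * m - i) = 0) := by
    intro i
    induction i with
    | zero => intro _; exact hlast
    | succ i ih =>
      intro hi
      apply hback _ (by omega)
      rw [show 2 * m - (i + 1) + 1 = 2 * m - i by omega]
      exact ih (by omega)
  have hZ' : ∀ k ≤ 2 * m, w k = 0 ∧ d0 k = 0 := by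
    intro k hk
    have := hZ (2 * m - k) (by omega)
    rwa [show 2 * m - (2 * m - k) = k by omega] at this
  have hfin : ∀ k < 2 * m + 1, up k = 0 ∧ dn k = 0 ∧ oR k = 0 ∧ oL (k + 1) = 0 ∧
        d0 (k + 1) = (tR k + tL (k + 1)) - (bR k + bL (k + 1)) := by
    intro k hk
    rcases hstep k hk (hinv k (by omega)) with h2 | h2 | h2
    · exact h2.2.2.2
    · exfalso
      rcases (show k < 2 * m ∨ k = 2 * m by omega) with h | rfl
      · have := (hZ' (k + 1) (by omega)).2
        have := hL1 (k + 1) (by omega)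
        omega
      · omega
    · exfalso
      rcases (show k < 2 * m ∨ k = 2 * m by omega) with h | rfl
      · have := (hZ' (k + 1) (by omega)).2
        have := hL1 (k + 1) (by omega)
        omega
      · omega
  have hoL : ∀ k < 2 * m + 1, oL k = 0 := by
    intro k hk
    rcases k with _ | k
    · exact (hinv0.2 (hZ' 0 (by omega)).1).1
    · exact (hfin k (by omega)).2.2.2.1
  have hpar : ∀ i ≤ m, tL (2 * i) = 0 ∧ bL (2 * i) = 0 ∧ (i < m →
      tR (2 * i) + bR (2 * i) = 1 ∧ tL (2 * i + 1) = bR (2 * i) ∧ bL (2 * i + 1) = tR (2 * i)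
      ∧ tR (2 * i + 1) = 0 ∧ bR (2 * i + 1) = 0) := by
    have second : ∀ i, i < m → tL (2 * i) = 0 → bL (2 * i) = 0 →
      tR (2 * i) + bR (2 * i) = 1 ∧ tL (2 * i + 1) = bR (2 * i) ∧ bL (2 * i + 1) = tR (2 * i)
      ∧ tR (2 * i + 1) = 0 ∧ bR (2 * i + 1) = 0 := by
      intro i hi h1 h2
      have f1 := hfin (2 * i) (by omega)
      have f2 := hfin (2 * i + 1) (by omega)
      have s1 := hsum (2 * i) (by omega)
      have s2 := hsum (2 * i + 1) (by omega)
      have n1 := hnn (2 * i)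
      have n2 := hnn (2 * i + 1)
      have o1 := hoL (2 * i) (by omega)
      have z := (hZ' (2 * i + 1) (by omega)).2
      refine ⟨?_, ?_, ?_, ?_, ?_⟩ <;> omega
    intro i
    induction i with
    | zero =>
      intro _
      have h1 := (hinv0.2 (hZ' 0 (by omega)).1).2
      have h2 := (hZ' 0 (by omega)).2
      have h3 := hL1 0 (by omega)
      have h4 := hnn 0
      have e1 : tL 0 = 0 := by omega
      have e2 : bL 0 = 0 := by omega
      exact ⟨e1, e2, fun h => second 0 h e1 e2⟩
    | succ i ih =>
      intro hi
      obtain ⟨-, -, h⟩ := ih (by omega)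
      have h5 := h (by omega)
      have f2 := hfin (2 * i + 1) (by omega)
      rw [show 2 * i + 1 + 1 = 2 * i + 2 from rfl] at f2
      have z := (hZ' (2 * i + 2) (by omega)).2
      have h3 := hL1 (2 * i + 2) (by omega)
      have h4 := hnn (2 * i + 2)
      have e1 : tL (2 * (i + 1)) = 0 := by
        change tL (2 * i + 2) = 0
        omega
      have e2 : bL (2 * (i + 1)) = 0 := by
        change bL (2 * i + 2) = 0
        omega
      exact ⟨e1, e2, fun h => second (i + 1) h e1 e2⟩
  refine ⟨fun i hi => ?_, ?_⟩
  · have := (hpar i hi.le).2.2 hi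
    exact ⟨this.1, this.2.1, this.2.2.1⟩
  · have h1 := hpar m le_rfl
    have f1 := hfin (2 * m) (by omega)
    have s1 := hsum (2 * m) (by omega)
    have n1 := hnn (2 * m)
    have n2 := hnn (2 * m + 1)
    omega

/-! ## Divisors in the set `Dtilde` -/

/-- indicator of a proposition -/
noncomputable def ind (p : Prop) : ℤ :=
  open scoped Classical in if p then 1 else 0

lemma ind_true {p : Prop} (h : p) : ind p = 1 := by
  unfold ind
  rw [if_pos h]

lemma ind_false {p : Prop} (h : ¬ p) : ind p = 0 := by
  unfold ind
  rw [if_neg h]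

lemma ind_nonneg (p : Prop) : 0 ≤ ind p := by
  by_cases h : p
  · rw [ind_true h]; norm_num
  · rw [ind_false h]

lemma ind_eq_one {p : Prop} (h : ind p = 1) : p := by
  by_contra h'
  rw [ind_false h'] at h
  omega

lemma ind_congr {p q : Prop} (h : p ↔ q) : ind p = ind q := by rw [propext h]

lemma ind_sum {xl xm xr yt yb yo : Prop} (hx : xl ∨ xm ∨ xr) (h1 : ¬(xl ∧ xm)) (h2 : ¬(xl ∧ xr))
    (h3 : ¬ (xm ∧ xr)) (hy : yt ∨ yb ∨ yo) (h4 : ¬(yt ∧ yb)) (h5 : ¬(yt ∧ yo))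
    (h6 : ¬ (yb ∧ yo)) (h7 : ¬(xm ∧ yo)) :
    ind (xl ∧ yt) + ind (xl ∧ yb) + ind (xl ∧ yo) + ind (xr ∧ yt) + ind (xr ∧ yb) + ind (xr ∧ yo)
      + ind (xm ∧ yt) + ind (xm ∧ yb) = 1 := by
  by_cases a1 : xl <;> by_cases a2 : xm <;> by_cases a3 : xr <;> by_cases a4 : yt <;>
    by_cases a5 : yb <;> by_cases a6 : yo <;> simp_all [ind]

lemma eq_gr_top {g : ℕ} {c : ℤ → ℝ} {P : ℝ × ℝ} {x : ℝ} :
    P = gr g c 1 x ↔ P.1 = x ∧ P.2 = c (-1) / 2 + qq g c P.1 := by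
  obtain ⟨a, b⟩ := P
  simp only [gr, Prod.mk.injEq]
  constructor
  · rintro ⟨rfl, rfl⟩
    simp
  · rintro ⟨rfl, rfl⟩
    simp

lemma eq_gr_bot {g : ℕ} {c : ℤ → ℝ} {P : ℝ × ℝ} {x : ℝ} :
    P = gr g c (-1) x ↔ P.1 = x ∧ P.2 = c (-1) / 2 - qq g c P.1 := by
  obtain ⟨a, b⟩ := P
  simp only [gr, Prod.mk.injEq]
  constructor
  · rintro ⟨rfl, rfl⟩
    simp [sub_eq_add_neg]
  · rintro ⟨rfl, rfl⟩
    simp [sub_eq_add_neg]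

/-- the point is strictly inside a rung -/
def yo (g : ℕ) (c : ℤ → ℝ) (P : ℝ × ℝ) : Prop := |P.2 - c (-1) / 2| < qq g c P.1

lemma alphaOpen_iff {g : ℕ} {c : ℤ → ℝ} (hc : Hyp g c) {k : ℕ} (hk : k ≤ g) (P : ℝ × ℝ) :
    P ∈ alphaOpen g c (g - k) ↔ P.1 = bb c k ∧ yo g c P := by
  unfold alphaOpen
  rw [conjV_eq hc hk, V_eq hc hk]
  simp only [Set.mem_ofPred_eq, ne_eq, eq_gr_top, eq_gr_bot]
  have h1 : (gr g c 1 (bb c k)).1 = bb c k := rfl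
  rw [h1]
  obtain ⟨x, y⟩ := P
  simp only [yo]
  have hq := qq_pos hc x
  constructor
  · rintro ⟨h, h2, h3, h4⟩
    refine ⟨h2, lt_of_le_of_ne ?_ ?_⟩
    · rw [mem_Gam hc] at h
      rcases h.2 with h | ⟨j, -, -, h⟩
      · exact h.le
      · exact h
    · intro h5
      rcases abs_sub_eq_cases h5 with h | h
      · exact h3 ⟨h2, h⟩
      · exact h4 ⟨h2, h⟩
  · rintro ⟨rfl, h⟩
    refine ⟨rung_mem hc hk h.le, rfl, ?_, ?_⟩
    · rintro ⟨-, h'⟩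
      rw [h', add_sub_cancel_left, abs_of_pos hq] at h
      exact lt_irrefl _ h
    · rintro ⟨-, h'⟩
      rw [h', sub_sub_cancel_left, abs_neg, abs_of_pos hq] at h
      exact lt_irrefl _ h

/-- reindexed description of `Dtilde` -/
def Good (g : ℕ) (c : ℤ → ℝ) (Q : ℕ → ℝ × ℝ) : Prop :=
  (∀ j < g, Q j ∈ Gam g c ∧ bb c j ≤ (Q j).1 ∧ (Q j).1 ≤ bb c (j + 1)) ∧
  (∀ k, 1 ≤ k → k < g → ∀ i < g, ∀ j < g, (Q i).1 = bb c k → yo g c (Q i) →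
    (Q j).1 = bb c k → yo g c (Q j) → i = j)

lemma alphaCycle_iff {g : ℕ} {c : ℤ → ℝ} (hc : Hyp g c) {j : ℕ} (hj : j < g) (P : ℝ × ℝ) :
    P ∈ alphaCycle g c (g - 1 - j + 1) ↔ P ∈ Gam g c ∧ bb c j ≤ P.1 ∧ P.1 ≤ bb c (j + 1) := by
  unfold alphaCycle
  rw [show g - 1 - j + 1 - 1 = g - (j + 1) by omega, show g - 1 - j + 1 = g - j by omega,
    V_eq hc hj.le, V_eq hc hj]
  rfl

lemma Dtilde_elim {g : ℕ} {c : ℤ → ℝ} (hc : Hyp g c) {D : Div} (h : D ∈ Dtilde g c) :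
    ∃ Q, Good g c Q ∧ D = ∑ j ∈ Finset.range g, Finsupp.single (Q j) (1 : ℤ) := by
  obtain ⟨Pt, h1, h2, h3⟩ := h
  let R : ℕ → ℝ × ℝ := fun i => if h : i < g then Pt ⟨i, h⟩ else 0
  have hR : ∀ i (h : i < g), R i = Pt ⟨i, h⟩ := fun i h => dif_pos h
  refine ⟨fun j => R (g - 1 - j), ⟨fun j hj => ?_, fun k hk hk' i hi j hj a1 a2 a3 a4 => ?_⟩, ?_⟩
  · simp only [hR (g - 1 - j) (by omega)]
    exact (alphaCycle_iff hc hj _).mp (h1 ⟨g - 1 - j, by omega⟩)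
  · simp only [hR (g - 1 - j) (by omega)] at a3 a4
    simp only [hR (g - 1 - i) (by omega)] at a1 a2
    have := h2 (g - k) (by omega) (by omega) _ _ ((alphaOpen_iff hc hk'.le _).mpr ⟨a1, a2⟩)
      ((alphaOpen_iff hc hk'.le _).mpr ⟨a3, a4⟩)
    simp only [Fin.mk.injEq] at this
    omega
  · rw [Finset.sum_range_reflect (fun j => Finsupp.single (R j) (1 : ℤ)), h3,
      ← Fin.sum_univ_eq_sum_range (fun j => Finsupp.single (R j) (1 : ℤ))]
    refine Finset.sum_congr rfl fun i _ => ?_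
    rw [hR i i.2]

lemma Dtilde_intro {g : ℕ} {c : ℤ → ℝ} (hc : Hyp g c) {Q : ℕ → ℝ × ℝ} (h : Good g c Q) :
    (∑ j ∈ Finset.range g, Finsupp.single (Q j) (1 : ℤ)) ∈ Dtilde g c := by
  obtain ⟨h1, h2⟩ := h
  refine ⟨fun i => Q (g - 1 - i), fun i => ?_, fun k hk hk' i j a1 a2 => ?_, ?_⟩
  · have hi := i.2
    have := (alphaCycle_iff hc (j := g - 1 - i) (by omega) _).mpr (h1 (g - 1 - i) (by omega))
    rwa [show g - 1 - (g - 1 - (i : ℕ)) + 1 = i + 1 by omega] at this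
  · have hi := i.2
    have hj := j.2
    rw [show k = g - (g - k) by omega, alphaOpen_iff hc (by omega)] at a1 a2
    have := h2 (g - k) (by omega) (by omega) _ (by omega) _ (by omega) a1.1 a1.2 a2.1 a2.2
    ext
    omega
  · rw [← Finset.sum_range_reflect, ← Fin.sum_univ_eq_sum_range]

lemma sum_pairs {M : Type*} [AddCommMonoid M] (f : ℕ → M) (m : ℕ) :
    ∑ j ∈ Finset.range (2 * m + 1), f j =
      ∑ i ∈ Finset.range m, (f (2 * i) + f (2 * i + 1)) + f (2 * m) := by
  rw [Finset.sum_range_succ]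
  congr 1
  induction m with
  | zero => simp
  | succ m ih =>
    rw [show 2 * (m + 1) = 2 * m + 1 + 1 by ring, Finset.sum_range_succ, Finset.sum_range_succ, ih,
      Finset.sum_range_succ, add_assoc]

lemma not_yo_gr {g : ℕ} {c : ℤ → ℝ} (hc : Hyp g c) {σ : ℤ} (hσ : σ = 1 ∨ σ = -1) (x : ℝ) :
    ¬ yo g c (gr g c σ x) := by
  have hq := qq_pos hc x
  unfold yo gr
  rcases hσ with rfl | rfl <;> simp [abs_of_pos hq]

lemma O_mem {m : ℕ} {c : ℤ → ℝ} (hc : Hyp (2 * m + 1) c) :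
    OdivOdd (2 * m + 1) c ∈ Dtilde (2 * m + 1) c := by
  let Q : ℕ → ℝ × ℝ := fun j =>
    if Even j then gr (2 * m + 1) c 1 (bb c (j + 1)) else gr (2 * m + 1) c (-1) (bb c j)
  have hE : ∀ i, Q (2 * i) = gr (2 * m + 1) c 1 (bb c (2 * i + 1)) := fun i =>
    if_pos (even_two_mul i)
  have hO : ∀ i, Q (2 * i + 1) = gr (2 * m + 1) c (-1) (bb c (2 * i + 1)) := fun i =>
    if_neg (by simp)
  have hb : ∀ k ≤ 2 * m + 1, bb c 0 ≤ bb c k ∧ bb c k ≤ 0 := by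
    intro k hk
    refine ⟨bb_le hc (by omega) hk, ?_⟩
    rw [← bb_top hc]
    exact bb_le hc hk le_rfl
  have hy : ∀ j, ¬ yo (2 * m + 1) c (Q j) := by
    intro j
    rcases Nat.even_or_odd' j with ⟨i, rfl | rfl⟩
    · rw [hE]
      exact not_yo_gr hc (Or.inl rfl) _
    · rw [hO]
      exact not_yo_gr hc (Or.inr rfl) _
  have : Good (2 * m + 1) c Q := by
    refine ⟨fun j hj => ?_, fun k _ _ i _ j _ _ a2 => absurd a2 (hy i)⟩
    rcases Nat.even_or_odd' j with ⟨i, rfl | rfl⟩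
    · rw [hE]
      exact ⟨gr_mem hc (Or.inl rfl) (hb _ (by omega)).1 (hb _ (by omega)).2, (bb_lt hc hj).le, le_rfl⟩
    · rw [hO]
      exact ⟨gr_mem hc (Or.inr rfl) (hb _ (by omega)).1 (hb _ (by omega)).2, le_rfl, (bb_lt hc hj).le⟩
  have h := Dtilde_intro hc this
  rw [sum_pairs, add_comm (Finset.sum _ _)] at h
  simp only [hE, hO] at h
  rw [Odiv_eq hc]
  exact h

/-! ## Evaluation of the divisor -/

lemma E_apply (g : ℕ) (Q : ℕ → ℝ × ℝ) (P : ℝ × ℝ) :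
    (∑ j ∈ Finset.range g, Finsupp.single (Q j) (1 : ℤ)) P =
      ∑ j ∈ Finset.range g, ind (Q j = P) := by
  classical
  rw [Finsupp.finsetSum_apply]
  refine Finset.sum_congr rfl fun j _ => ?_
  rw [Finsupp.single_apply]
  by_cases h : Q j = P
  · rw [if_pos h, ind_true h]
  · rw [if_neg h, ind_false h]

lemma E_strip {g : ℕ} {c : ℤ → ℝ} (hc : Hyp g c) {Q : ℕ → ℝ × ℝ} (hQ : Good g c Q) {k : ℕ}
    (hk : k < g) {P : ℝ × ℝ} (h1 : bb c k < P.1) (h2 : P.1 < bb c (k + 1)) :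
    ∑ j ∈ Finset.range g, ind (Q j = P) = ind (Q k = P) := by
  apply Finset.sum_eq_single k
  · intro j hj hjk
    apply ind_false
    rintro rfl
    rw [Finset.mem_range] at hj
    obtain ⟨-, h3, h4⟩ := hQ.1 j hj
    have a1 := (bb_lt_iff hc (by omega) (by omega)).mp (h1.trans_le h4)
    have a2 := (bb_lt_iff hc (by omega) (by omega)).mp (h3.trans_lt h2)
    omega
  · intro h
    exact absurd (Finset.mem_range.mpr hk) h

lemma E_rung0 {g : ℕ} {c : ℤ → ℝ} (hc : Hyp g c) {Q : ℕ → ℝ × ℝ} (hQ : Good g c Q)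
    (hg : 0 < g) {P : ℝ × ℝ} (h1 : P.1 = bb c 0) :
    ∑ j ∈ Finset.range g, ind (Q j = P) = ind (Q 0 = P) := by
  apply Finset.sum_eq_single 0
  · intro j hj hjk
    apply ind_false
    rintro rfl
    rw [Finset.mem_range] at hj
    obtain ⟨-, h3, h4⟩ := hQ.1 j hj
    have := bb_strict hc (i := 0) (j := j) (by omega) (by omega)
    linarith
  · intro h
    exact absurd (Finset.mem_range.mpr hg) h

lemma E_rungS {g : ℕ} {c : ℤ → ℝ} (hc : Hyp g c) {Q : ℕ → ℝ × ℝ} (hQ : Good g c Q) {k : ℕ}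
    (hk : k < g) {P : ℝ × ℝ} (h1 : P.1 = bb c (k + 1)) :
    ∑ j ∈ Finset.range g, ind (Q j = P) = ind (Q k = P) + ind (k + 1 < g ∧ Q (k + 1) = P) := by
  have hz : ∀ j < g, j ≠ k → j ≠ k + 1 → ind (Q j = P) = 0 := by
    intro j hj a b
    apply ind_false
    rintro rfl
    obtain ⟨-, h3, h4⟩ := hQ.1 j hj
    rw [h1] at h3 h4
    have a1 : ¬ (j + 1 < k + 1) := by
      rw [← bb_lt_iff hc (by omega) (by omega)]
      exact not_lt.mpr h4
    have a2 : ¬ (k + 1 < j) := by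
      rw [← bb_lt_iff hc (by omega) (by omega)]
      exact not_lt.mpr h3
    omega
  by_cases hk1 : k + 1 < g
  · have hs : ({k, k + 1} : Finset ℕ) ⊆ Finset.range g := by
      intro j hj
      simp only [Finset.mem_insert, Finset.mem_singleton] at hj
      rw [Finset.mem_range]
      omega
    rw [← Finset.sum_subset hs, Finset.sum_pair (by omega)]
    · congr 1
      exact ind_congr (by simp [hk1])
    · intro j hj hj'
      simp only [Finset.mem_insert, Finset.mem_singleton, not_or] at hj'
      exact hz j (Finset.mem_range.mp hj) hj'.1 hj'.2
  · rw [ind_false (p := k + 1 < g ∧ Q (k + 1) = P) (fun h => hk1 h.1), add_zero]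
    apply Finset.sum_eq_single k
    · intro j hj hjk
      have := Finset.mem_range.mp hj
      exact hz j this hjk (by omega)
    · intro h
      exact absurd (Finset.mem_range.mpr hk) h

/-! ## Slopes along edges -/

lemma rs_gr {g : ℕ} {c : ℤ → ℝ} (hc : Hyp g c) {f : ℝ × ℝ → ℝ} (hf : IsRationalFn (Gam g c) f)
    {k : ℕ} (hk : k < g) {σ : ℤ} (hσ : σ = 1 ∨ σ = -1) {x : ℝ} (h1 : bb c k ≤ x)
    (h2 : x < bb c (k + 1)) :
    HasRS (fun x => f (gr g c σ x)) x
      (slope (Gam g c) f (gr g c σ x) (1, σ * ((k : ℤ) + 1))) := by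
  have hb0 := bb_le hc (Nat.zero_le k) hk.le
  have hb1 := bb_le hc (i := k + 1) (j := g) (by omega) le_rfl
  rw [bb_top hc] at hb1
  obtain ⟨ε, hε, h⟩ := slope_spec hf (gr_mem hc hσ (hb0.trans h1) (h2.le.trans hb1))
    (right_mem hc hk hσ h1 h2)
  refine ⟨min ε (bb c (k + 1) - x), lt_min hε (by linarith), fun t h0 ht => ?_⟩
  rw [lt_min_iff] at ht
  have e := gr_right hc hk σ (x := x) (t := t) ⟨h1, h2.le⟩ ⟨by linarith, by linarith⟩
  have := h t h0 ht.1
  rw [e] at this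
  exact this (gr_mem hc hσ (by linarith) (by linarith))

lemma ls_gr {g : ℕ} {c : ℤ → ℝ} (hc : Hyp g c) {f : ℝ × ℝ → ℝ} (hf : IsRationalFn (Gam g c) f)
    {k : ℕ} (hk : k < g) {σ : ℤ} (hσ : σ = 1 ∨ σ = -1) {x : ℝ} (h1 : bb c k < x)
    (h2 : x ≤ bb c (k + 1)) :
    HasLS (fun x => f (gr g c σ x)) x
      (slope (Gam g c) f (gr g c σ x) (-1, -(σ * ((k : ℤ) + 1)))) := by
  have hb0 := bb_le hc (Nat.zero_le k) hk.le
  have hb1 := bb_le hc (i := k + 1) (j := g) (by omega) le_rfl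
  rw [bb_top hc] at hb1
  obtain ⟨ε, hε, h⟩ := slope_spec hf (gr_mem hc hσ (hb0.trans h1.le) (h2.trans hb1))
    (left_mem hc hk hσ h1 h2)
  refine ⟨min ε (x - bb c k), lt_min hε (by linarith), fun t h0 ht => ?_⟩
  rw [lt_min_iff] at ht
  have e := gr_left hc hk σ (x := x) (t := t) ⟨h1.le, h2⟩ ⟨by linarith, by linarith⟩
  have := h t h0 ht.1
  rw [e] at this
  exact this (gr_mem hc hσ (by linarith) (by linarith))

lemma rs_rung {g : ℕ} {c : ℤ → ℝ} (hc : Hyp g c) {f : ℝ × ℝ → ℝ} (hf : IsRationalFn (Gam g c) f)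
    {k : ℕ} (hk : k ≤ g) {y : ℝ} (h1 : c (-1) / 2 - qq g c (bb c k) ≤ y)
    (h2 : y < c (-1) / 2 + qq g c (bb c k)) :
    HasRS (fun y => f (bb c k, y)) y (slope (Gam g c) f (bb c k, y) (0, 1)) := by
  obtain ⟨ε, hε, h⟩ := slope_spec hf
    (rung_mem hc hk (y := y) (abs_le.mpr ⟨by linarith, by linarith⟩)) (up_mem hc hk h1 h2)
  refine ⟨min ε (c (-1) / 2 + qq g c (bb c k) - y), lt_min hε (by linarith), fun t h0 ht => ?_⟩
  rw [lt_min_iff] at ht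
  have e : (bb c k, y) + t • vr (0, 1) = (bb c k, y + t) := by simp [vr]
  have := h t h0 ht.1
  rw [e] at this
  exact this (rung_mem hc hk (abs_le.mpr ⟨by linarith, by linarith⟩))

lemma ls_rung {g : ℕ} {c : ℤ → ℝ} (hc : Hyp g c) {f : ℝ × ℝ → ℝ} (hf : IsRationalFn (Gam g c) f)
    {k : ℕ} (hk : k ≤ g) {y : ℝ} (h1 : c (-1) / 2 - qq g c (bb c k) < y)
    (h2 : y ≤ c (-1) / 2 + qq g c (bb c k)) :
    HasLS (fun y => f (bb c k, y)) y (slope (Gam g c) f (bb c k, y) (0, -1)) := by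
  obtain ⟨ε, hε, h⟩ := slope_spec hf
    (rung_mem hc hk (y := y) (abs_le.mpr ⟨by linarith, by linarith⟩)) (down_mem hc hk h1 h2)
  refine ⟨min ε (y - (c (-1) / 2 - qq g c (bb c k))), lt_min hε (by linarith),
    fun t h0 ht => ?_⟩
  rw [lt_min_iff] at ht
  have e : (bb c k, y) + t • vr (0, -1) = (bb c k, y - t) := by simp [vr, sub_eq_add_neg]
  have := h t h0 ht.1
  rw [e] at this
  exact this (rung_mem hc hk (abs_le.mpr ⟨by linarith, by linarith⟩))

lemma cont_gr {g : ℕ} {c : ℤ → ℝ} (hc : Hyp g c) {f : ℝ × ℝ → ℝ} (hf : IsRationalFn (Gam g c) f)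
    {k : ℕ} (hk : k < g) {σ : ℤ} (hσ : σ = 1 ∨ σ = -1) :
    ContinuousOn (fun x => f (gr g c σ x)) (Set.Icc (bb c k) (bb c (k + 1))) := by
  have hb0 := bb_le hc (Nat.zero_le k) hk.le
  have hb1 := bb_le hc (i := k + 1) (j := g) (by omega) le_rfl
  rw [bb_top hc] at hb1
  have hqc := qq_cont g c
  refine ContinuousOn.comp (g := f) (t := Gam g c) hf.cont ?_ ?_
  · unfold gr
    fun_prop
  · intro x hx
    exact gr_mem hc hσ (hb0.trans hx.1) (hx.2.trans hb1)

lemma cont_rung {g : ℕ} {c : ℤ → ℝ} (hc : Hyp g c) {f : ℝ × ℝ → ℝ}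
    (hf : IsRationalFn (Gam g c) f) {k : ℕ} (hk : k ≤ g) :
    ContinuousOn (fun y => f (bb c k, y))
      (Set.Icc (c (-1) / 2 - qq g c (bb c k)) (c (-1) / 2 + qq g c (bb c k))) := by
  refine ContinuousOn.comp (g := f) (t := Gam g c) hf.cont ?_ ?_
  · fun_prop
  · intro y hy
    exact rung_mem hc hk (abs_le.mpr ⟨by linarith [hy.1], by linarith [hy.2]⟩)

lemma gr_top_mk (g : ℕ) (c : ℤ → ℝ) (x : ℝ) : gr g c 1 x = (x, c (-1) / 2 + qq g c x) := by
  simp [gr]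

lemma gr_bot_mk (g : ℕ) (c : ℤ → ℝ) (x : ℝ) : gr g c (-1) x = (x, c (-1) / 2 - qq g c x) := by
  simp [gr, sub_eq_add_neg]

/-- the edge lemma on the two horizontal edges over strip `k` -/
lemma strip_edge {g : ℕ} {c : ℤ → ℝ} (hc : Hyp g c) {f : ℝ × ℝ → ℝ}
    (hf : IsRationalFn (Gam g c) f) {k : ℕ} (hk : k < g) (P : ℝ × ℝ)
    (hord : ∀ σ : ℤ, (σ = 1 ∨ σ = -1) → ∀ x, bb c k < x → x < bb c (k + 1) →
      ord (Gam g c) f (gr g c σ x) = ind (P = gr g c σ x)) :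
    let s : ℤ → ℤ := fun σ => slope (Gam g c) f (gr g c σ (bb c k)) (1, σ * ((k : ℤ) + 1))
    let s' : ℤ → ℤ := fun σ =>
      slope (Gam g c) f (gr g c σ (bb c (k + 1))) (-1, -(σ * ((k : ℤ) + 1)))
    let w : ℝ → ℝ := fun x => f (gr g c 1 x) - f (gr g c (-1) x)
    (∃ α > (0 : ℝ), ∃ β > (0 : ℝ), w (bb c (k + 1)) - w (bb c k) =
      ((s 1 - s (-1) : ℤ) : ℝ) * α + ((-(s' 1 - s' (-1)) : ℤ) : ℝ) * β) ∧
    -(s' 1 - s' (-1)) = (s 1 - s (-1)) +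
      (ind ((bb c k < P.1 ∧ P.1 < bb c (k + 1)) ∧ P.2 = c (-1) / 2 + qq g c P.1) -
       ind ((bb c k < P.1 ∧ P.1 < bb c (k + 1)) ∧ P.2 = c (-1) / 2 - qq g c P.1)) := by
  intro s s' w
  have hb := bb_lt hc hk
  have l1 : (1 : ℤ) = 1 ∨ (1 : ℤ) = -1 := Or.inl rfl
  have l2 : (-1 : ℤ) = 1 ∨ (-1 : ℤ) = -1 := Or.inr rfl
  refine edge_lemma hb ((cont_gr hc hf hk l1).sub (cont_gr hc hf hk l2))
    (fun x => ind (P = gr g c 1 x) - ind (P = gr g c (-1) x)) _ ?_ ?_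
    ((rs_gr hc hf hk l1 le_rfl hb).sub (rs_gr hc hf hk l2 le_rfl hb))
    ((ls_gr hc hf hk l1 hb le_rfl).sub (ls_gr hc hf hk l2 hb le_rfl))
  · intro x hx
    refine ⟨_, _, (rs_gr hc hf hk l1 hx.1.le hx.2).sub (rs_gr hc hf hk l2 hx.1.le hx.2),
      (ls_gr hc hf hk l1 hx.1 hx.2.le).sub (ls_gr hc hf hk l2 hx.1 hx.2.le), ?_⟩
    have o1 := ord_strip hc f hk l1 hx.1 hx.2
    have o2 := ord_strip hc f hk l2 hx.1 hx.2
    rw [hord _ l1 x hx.1 hx.2] at o1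
    rw [hord _ l2 x hx.1 hx.2] at o2
    omega
  · by_cases hP : bb c k < P.1 ∧ P.1 < bb c (k + 1)
    · right
      refine ⟨P.1, hP, ?_, ?_⟩
      · simp only [eq_gr_top, eq_gr_bot, hP, true_and, and_self]
      · intro x _ hx'
        simp only [eq_gr_top, eq_gr_bot, hx'.symm, false_and, sub_self]
    · left
      refine ⟨fun x hx => ?_, ?_⟩
      · have : P.1 ≠ x := by
          rintro rfl
          exact hP hx
        simp only [eq_gr_top, eq_gr_bot, this, false_and, sub_self]
      · simp only [hP, false_and, sub_self]

/-- the edge lemma on rung `k` -/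
lemma rung_edge {g : ℕ} {c : ℤ → ℝ} (hc : Hyp g c) {f : ℝ × ℝ → ℝ}
    (hf : IsRationalFn (Gam g c) f) {k : ℕ} (hk : k ≤ g) (A B : Prop) (Pa Pb : ℝ × ℝ)
    (hAB : ¬ ((A ∧ Pa.1 = bb c k ∧ yo g c Pa) ∧ (B ∧ Pb.1 = bb c k ∧ yo g c Pb)))
    (hord : ∀ y, |y - c (-1) / 2| < qq g c (bb c k) →
      ord (Gam g c) f (bb c k, y) = ind (A ∧ Pa = (bb c k, y)) + ind (B ∧ Pb = (bb c k, y))) :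
    let sb : ℤ := slope (Gam g c) f (gr g c (-1) (bb c k)) (0, 1)
    let st : ℤ := slope (Gam g c) f (gr g c 1 (bb c k)) (0, -1)
    (∃ α > (0 : ℝ), ∃ β > (0 : ℝ), f (gr g c 1 (bb c k)) - f (gr g c (-1) (bb c k)) =
      (sb : ℝ) * α + ((-st : ℤ) : ℝ) * β) ∧
    -st = sb + (ind (A ∧ Pa.1 = bb c k ∧ yo g c Pa) + ind (B ∧ Pb.1 = bb c k ∧ yo g c Pb)) := by
  have hq := qq_pos hc (bb c k)
  have hab : c (-1) / 2 - qq g c (bb c k) < c (-1) / 2 + qq g c (bb c k) := by linarith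
  rw [gr_top_mk, gr_bot_mk]
  have hne : ∀ P : ℝ × ℝ, ∀ y : ℝ, |y - c (-1) / 2| < qq g c (bb c k) →
      P = (bb c k, y) → P.1 = bb c k ∧ yo g c P := by
    rintro P y h rfl
    exact ⟨rfl, h⟩
  have habs : ∀ y ∈ Set.Ioo (c (-1) / 2 - qq g c (bb c k)) (c (-1) / 2 + qq g c (bb c k)),
      |y - c (-1) / 2| < qq g c (bb c k) := fun y hy =>
    abs_lt.mpr ⟨by linarith [hy.1], by linarith [hy.2]⟩
  have hmem : ∀ P : ℝ × ℝ, P.1 = bb c k → yo g c P →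
      P.2 ∈ Set.Ioo (c (-1) / 2 - qq g c (bb c k)) (c (-1) / 2 + qq g c (bb c k)) := by
    intro P h1 h2
    unfold yo at h2
    rw [h1, abs_lt] at h2
    exact ⟨by linarith [h2.1], by linarith [h2.2]⟩
  refine edge_lemma hab (cont_rung hc hf hk)
    (fun y => ind (A ∧ Pa = (bb c k, y)) + ind (B ∧ Pb = (bb c k, y))) _ ?_ ?_
    (rs_rung hc hf hk le_rfl hab) (ls_rung hc hf hk hab le_rfl)
  · intro y hy
    refine ⟨_, _, rs_rung hc hf hk hy.1.le hy.2, ls_rung hc hf hk hy.1 hy.2.le, ?_⟩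
    have hy' := habs y hy
    rw [← ord_rung hc f hk hy', hord y hy']
  · by_cases ha : A ∧ Pa.1 = bb c k ∧ yo g c Pa
    · have hb : ¬ (B ∧ Pb.1 = bb c k ∧ yo g c Pb) := fun h => hAB ⟨ha, h⟩
      right
      refine ⟨Pa.2, hmem _ ha.2.1 ha.2.2, ?_, ?_⟩
      · rw [ind_true ha, ind_false hb, ind_true ⟨ha.1, Prod.ext ha.2.1 rfl⟩, ind_false]
        rintro ⟨h1, h2⟩
        exact hb ⟨h1, hne _ _ (habs _ (hmem _ ha.2.1 ha.2.2)) h2⟩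
      · intro y hy hya
        rw [ind_false, ind_false]
        · norm_num
        · rintro ⟨h1, h2⟩
          exact hb ⟨h1, hne _ _ (habs y hy) h2⟩
        · rintro ⟨h1, h2⟩
          exact hya (by rw [h2])
    · by_cases hb : B ∧ Pb.1 = bb c k ∧ yo g c Pb
      · right
        refine ⟨Pb.2, hmem _ hb.2.1 hb.2.2, ?_, ?_⟩
        · rw [ind_true hb, ind_false ha, 
            ind_true (p := B ∧ Pb = (bb c k, Pb.2)) ⟨hb.1, Prod.ext hb.2.1 rfl⟩, ind_false]
          rintro ⟨h1, h2⟩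
          exact ha ⟨h1, hne _ _ (habs _ (hmem _ hb.2.1 hb.2.2)) h2⟩
        · intro y hy hya
          rw [ind_false, ind_false]
          · norm_num
          · rintro ⟨h1, h2⟩
            exact hya (by rw [h2])
          · rintro ⟨h1, h2⟩
            exact ha ⟨h1, hne _ _ (habs y hy) h2⟩
      · left
        refine ⟨fun y hy => ?_, ?_⟩
        · rw [ind_false, ind_false]
          · norm_num
          · rintro ⟨h1, h2⟩
            exact hb ⟨h1, hne _ _ (habs y hy) h2⟩
          · rintro ⟨h1, h2⟩
            exact ha ⟨h1, hne _ _ (habs y hy) h2⟩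
        · rw [ind_false ha, ind_false hb]
          norm_num

/-! ## Uniqueness -/

lemma Dstar_strip {m : ℕ} {c : ℤ → ℝ} (hc : Hyp (2 * m + 1) c) {k : ℕ} (hk : k < 2 * m + 1)
    (σ : ℤ) {x : ℝ} (h1 : bb c k < x) (h2 : x < bb c (k + 1)) :
    DstarOdd (2 * m + 1) c (gr (2 * m + 1) c σ x) = 0 := by
  rw [Dstar_eq hc, pairDiv]
  simp only [Finsupp.add_apply, Finsupp.smul_apply, single_gr_strip hc le_rfl hk _ _ h1 h2]
  simp

lemma Dstar_rung {m : ℕ} {c : ℤ → ℝ} (hc : Hyp (2 * m + 1) c) {k : ℕ} (hk : k ≤ 2 * m + 1)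
    {y : ℝ} (h : |y - c (-1) / 2| < qq (2 * m + 1) c (bb c k)) :
    DstarOdd (2 * m + 1) c (bb c k, y) = 0 := by
  rw [Dstar_eq hc, pairDiv]
  simp only [Finsupp.add_apply, Finsupp.smul_apply, single_gr_rung hc le_rfl hk (Or.inl rfl) h,
    single_gr_rung hc le_rfl hk (Or.inr rfl) h]
  simp

lemma Dstar_vertex {m : ℕ} {c : ℤ → ℝ} (hc : Hyp (2 * m + 1) c) {k : ℕ} (hk : k ≤ 2 * m + 1) :
    DstarOdd (2 * m + 1) c (gr (2 * m + 1) c 1 (bb c k)) -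
      DstarOdd (2 * m + 1) c (gr (2 * m + 1) c (-1) (bb c k)) =
      if k < 2 * m + 1 then 0 else 1 := by
  rw [Dstar_eq hc, pairDiv]
  simp only [Finsupp.add_apply, Finsupp.smul_apply, single_gr hc le_rfl hk]
  by_cases h : k < 2 * m + 1
  · have : 2 * m + 1 ≠ k := by omega
    simp [h, this]
  · have : k = 2 * m + 1 := by omega
    subst this
    simp

lemma uniq {m : ℕ} {c : ℤ → ℝ} (hc : Hyp (2 * m + 1) c) {Q : ℕ → ℝ × ℝ}
    (hQ : Good (2 * m + 1) c Q)
    (hP : IsPrincipal (Gam (2 * m + 1) c)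
      (∑ j ∈ Finset.range (2 * m + 1), Finsupp.single (Q j) (1 : ℤ) - DstarOdd (2 * m + 1) c)) :
    ∑ j ∈ Finset.range (2 * m + 1), Finsupp.single (Q j) (1 : ℤ) = OdivOdd (2 * m + 1) c := by
  obtain ⟨f, hf, hD⟩ := hP
  have l1 : (1 : ℤ) = 1 ∨ (1 : ℤ) = -1 := Or.inl rfl
  have l2 : (-1 : ℤ) = 1 ∨ (-1 : ℤ) = -1 := Or.inr rfl
  have hord : ∀ P, ord (Gam (2 * m + 1) c) f P =
      ∑ j ∈ Finset.range (2 * m + 1), ind (Q j = P) - DstarOdd (2 * m + 1) c P := by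
    intro P
    rw [← hD, Finsupp.sub_apply, E_apply]
  -- vertex equations
  have hv : ∀ k ≤ 2 * m + 1,
      ((if k < 2 * m + 1 then slope (Gam (2 * m + 1) c) f (gr (2 * m + 1) c 1 (bb c k))
          (1, 1 * ((k : ℤ) + 1)) else 0) -
        (if k < 2 * m + 1 then slope (Gam (2 * m + 1) c) f (gr (2 * m + 1) c (-1) (bb c k))
          (1, (-1) * ((k : ℤ) + 1)) else 0)) +
      ((if 0 < k then slope (Gam (2 * m + 1) c) f (gr (2 * m + 1) c 1 (bb c k))
          (-1, -(1 * (k : ℤ))) else 0) -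
        (if 0 < k then slope (Gam (2 * m + 1) c) f (gr (2 * m + 1) c (-1) (bb c k))
          (-1, -((-1) * (k : ℤ))) else 0)) +
      slope (Gam (2 * m + 1) c) f (gr (2 * m + 1) c 1 (bb c k)) (0, -1) -
      slope (Gam (2 * m + 1) c) f (gr (2 * m + 1) c (-1) (bb c k)) (0, 1) =
      ∑ j ∈ Finset.range (2 * m + 1), ind (Q j = gr (2 * m + 1) c 1 (bb c k)) -
      ∑ j ∈ Finset.range (2 * m + 1), ind (Q j = gr (2 * m + 1) c (-1) (bb c k)) -
      if k < 2 * m + 1 then 0 else 1 := by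
    intro k hk
    have o1 := ord_vertex hc f hk l1
    have o2 := ord_vertex hc f hk l2
    rw [hord] at o1 o2
    rw [neg_neg] at o2
    have := Dstar_vertex hc hk
    rw [← this]
    linarith
  have hmain := comb_main m
    (fun k => f (gr (2 * m + 1) c 1 (bb c k)) - f (gr (2 * m + 1) c (-1) (bb c k)))
    (fun k => if k < 2 * m + 1 then
      slope (Gam (2 * m + 1) c) f (gr (2 * m + 1) c 1 (bb c k)) (1, 1 * ((k : ℤ) + 1)) -
      slope (Gam (2 * m + 1) c) f (gr (2 * m + 1) c (-1) (bb c k)) (1, (-1) * ((k : ℤ) + 1)) else 1)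
    (fun k =>
      -(slope (Gam (2 * m + 1) c) f (gr (2 * m + 1) c 1 (bb c (k + 1))) (-1, -(1 * ((k : ℤ) + 1))) -
      slope (Gam (2 * m + 1) c) f (gr (2 * m + 1) c (-1) (bb c (k + 1)))
        (-1, -((-1) * ((k : ℤ) + 1)))))
    (fun k => slope (Gam (2 * m + 1) c) f (gr (2 * m + 1) c (-1) (bb c k)) (0, 1))
    (fun k => -slope (Gam (2 * m + 1) c) f (gr (2 * m + 1) c 1 (bb c k)) (0, -1))
    (fun j => ind (j < 2 * m + 1 ∧ Q j = gr (2 * m + 1) c 1 (bb c j)))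
    (fun j => ind (j < 2 * m + 1 ∧ Q j = gr (2 * m + 1) c (-1) (bb c j)))
    (fun j => ind (j < 2 * m + 1 ∧ (Q j).1 = bb c j ∧ yo (2 * m + 1) c (Q j)))
    (fun j => ind (Q j = gr (2 * m + 1) c 1 (bb c (j + 1))))
    (fun j => ind (Q j = gr (2 * m + 1) c (-1) (bb c (j + 1))))
    (fun j => ind ((Q j).1 = bb c (j + 1) ∧ yo (2 * m + 1) c (Q j)))
    (fun j => ind ((bb c j < (Q j).1 ∧ (Q j).1 < bb c (j + 1)) ∧
      (Q j).2 = c (-1) / 2 + qq (2 * m + 1) c (Q j).1))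
    (fun j => ind ((bb c j < (Q j).1 ∧ (Q j).1 < bb c (j + 1)) ∧
      (Q j).2 = c (-1) / 2 - qq (2 * m + 1) c (Q j).1))
    ?hstrip ?hrung ?hst0 ?hst ?hd0 ?hd ?hdg ?hnn ?hsum ?hLg ?ho
  case hstrip =>
    intro j hj
    have h := strip_edge hc hf hj (Q j) (by
      intro σ hσ x h1 h2
      rw [hord, E_strip hc hQ hj (P := gr (2 * m + 1) c σ x) h1 h2, Dstar_strip hc hj σ h1 h2,
        sub_zero])
    simp only [if_pos hj]
    exact h
  case hrung =>
    intro k hk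
    rcases k with _ | k
    · exact (rung_edge hc hf hk False (0 < 2 * m + 1) (Q 0) (Q 0) (by tauto) (by
        intro y hy
        rw [hord, E_rung0 hc hQ (by omega) rfl, Dstar_rung hc hk hy]
        simp [ind])).1
    · exact (rung_edge hc hf hk True (k + 1 < 2 * m + 1) (Q k) (Q (k + 1)) (by
        rintro ⟨⟨-, a1, a2⟩, a3, a4, a5⟩
        have := hQ.2 (k + 1) (by omega) a3 k (by omega) (k + 1) a3 a1 a2 a4 a5
        omega) (by
        intro y hy
        rw [hord, E_rungS hc hQ (by omega) rfl, Dstar_rung hc hk hy, sub_zero, true_and])).1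
  case hst0 =>
    have h := (rung_edge hc hf (k := 0) (by omega) False (0 < 2 * m + 1) (Q 0) (Q 0) (by tauto) (by
        intro y hy
        rw [hord, E_rung0 hc hQ (by omega) rfl, Dstar_rung hc (by omega) hy]
        simp [ind])).2
    rw [ind_false (p := False ∧ _) (by tauto), zero_add] at h
    exact h
  case hst =>
    intro k hk
    have h := (rung_edge hc hf (k := k + 1) (by omega) True (k + 1 < 2 * m + 1) (Q k) (Q (k + 1)) (by
        rintro ⟨⟨-, a1, a2⟩, a3, a4, a5⟩
        have := hQ.2 (k + 1) (by omega) a3 k (by omega) (k + 1) a3 a1 a2 a4 a5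
        omega) (by
        intro y hy
        rw [hord, E_rungS hc hQ (by omega) rfl, Dstar_rung hc (by omega) hy, sub_zero, true_and])).2
    rw [true_and] at h
    exact h
  case hd0 =>
    have h := hv 0 (by omega)
    rw [E_rung0 hc hQ (by omega) rfl, E_rung0 hc hQ (by omega) rfl] at h
    have h0 : 0 < 2 * m + 1 := by omega
    simp only [h0, if_true, true_and, lt_irrefl, if_false] at h ⊢
    linarith
  case hd =>
    intro k hk
    have h := hv (k + 1) (by omega)
    rw [E_rungS hc hQ hk rfl, E_rungS hc hQ hk rfl] at h
    simp only [Nat.succ_pos, if_true] at h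
    push_cast at h ⊢
    by_cases hk1 : k + 1 < 2 * m + 1
    · simp only [hk1, if_true] at h ⊢
      linarith
    · simp only [hk1, if_false] at h ⊢
      linarith
  case hdg => simp
  case hnn =>
    intro j
    refine ⟨?_, ?_, ?_, ?_, ?_, ?_, ?_, ?_⟩ <;> exact ind_nonneg _
  case hsum =>
    intro j hj
    simp only [hj, true_and, eq_gr_top, eq_gr_bot]
    obtain ⟨h1, h2, h3⟩ := hQ.1 j hj
    have hb := bb_lt hc hj
    have hq := qq_pos hc (Q j).1
    have hle : |(Q j).2 - c (-1) / 2| ≤ qq (2 * m + 1) c (Q j).1 := by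
      rw [mem_Gam hc] at h1
      rcases h1.2 with h | ⟨_, _, _, h⟩
      · exact h.le
      · exact h
    apply ind_sum
    · rcases h2.eq_or_lt with h | h
      · exact Or.inl h.symm
      · rcases h3.eq_or_lt with h' | h'
        · exact Or.inr (Or.inr h')
        · exact Or.inr (Or.inl ⟨h, h'⟩)
    · rintro ⟨a, b, _⟩
      linarith
    · rintro ⟨a, b⟩
      linarith
    · rintro ⟨⟨_, a⟩, b⟩
      linarith
    · rcases hle.eq_or_lt with h | h
      · rcases abs_sub_eq_cases h with h | h
        · exact Or.inl h
        · exact Or.inr (Or.inl h)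
      · exact Or.inr (Or.inr h)
    · rintro ⟨a, b⟩
      linarith
    · rintro ⟨a, b⟩
      rw [yo, a, add_sub_cancel_left, abs_of_pos hq] at b
      exact lt_irrefl _ b
    · rintro ⟨a, b⟩
      rw [yo, a, sub_sub_cancel_left, abs_neg, abs_of_pos hq] at b
      exact lt_irrefl _ b
    · rintro ⟨a, b⟩
      have := interior_abs hc hj (x := (Q j).1) (y := (Q j).2) a h1
      rw [yo, this] at b
      exact lt_irrefl _ b
  case hLg => simp [ind]
  case ho =>
    intro k hk
    by_cases h1 : (Q k).1 = bb c (k + 1) ∧ yo (2 * m + 1) c (Q k)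
    · have h2 : ¬ (k + 1 < 2 * m + 1 ∧ (Q (k + 1)).1 = bb c (k + 1) ∧
          yo (2 * m + 1) c (Q (k + 1))) := by
        rintro ⟨a3, a4, a5⟩
        have := hQ.2 (k + 1) (by omega) a3 k (by omega) (k + 1) a3 h1.1 h1.2 a4 a5
        omega
      simp only [ind_true h1, ind_false h2]
      norm_num
    · simp only [ind_false h1, zero_add]
      unfold ind
      split_ifs <;> norm_num
  obtain ⟨hA, hB⟩ := hmain
  rw [sum_pairs, Odiv_eq hc, add_comm, ind_eq_one hB]
  congr 1
  refine Finset.sum_congr rfl fun i hi => ?_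
  obtain ⟨h1, h2, h3⟩ := hA i (Finset.mem_range.mp hi)
  unfold pairDiv
  by_cases h : Q (2 * i) = gr (2 * m + 1) c 1 (bb c (2 * i + 1))
  · rw [ind_true h] at h3
    rw [h, (ind_eq_one h3).2]
  · rw [ind_false h, zero_add] at h1
    rw [h1] at h2
    rw [ind_eq_one h1, (ind_eq_one h2).2, add_comm]

end TropProof

open TropicalHyperelliptic

/-- Let `g` be odd, `Γ̄` the tropical hyperelliptic curve of genus `g`, `Γ` its
bounded part, and `D* = ((g−1)/2)(V_0 + V_0′) + V_0`.  The divisor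
`V_0 + V_2 + V_4 + ⋯ + V_{g−1} + V_2′ + V_4′ + ⋯ + V_{g−1}′` lies in
`𝔇̃_g^+(Γ)` and is the unique element of `𝔇̃_g^+(Γ)` whose image under `φ̄` is
`0` in `J(Γ)` (i.e. whose difference with `D*` is principal); hence the
`g`-tuple `(V_0, V_2, V_4, …, V_{g−1}, V_2′, V_4′, …, V_{g−1}′)` is the unit
`𝒪` of the group `(Γ_g^+, 𝒪)`. -/
theorem unit_of_addition_odd (g : ℕ) (c : ℤ → ℝ) (hg : Odd g) (hg1 : 1 ≤ g)
    (hc : Hyp g c) :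
    OdivOdd g c ∈ Dtilde g c
    ∧ IsPrincipal (Gam g c) (OdivOdd g c - DstarOdd g c)
    ∧ ∀ E ∈ Dtilde g c, IsPrincipal (Gam g c) (E - DstarOdd g c) → E = OdivOdd g c := by
  obtain ⟨m, rfl⟩ := hg
  refine ⟨TropProof.O_mem hc, TropProof.O_principal hc, fun E hE hP => ?_⟩
  obtain ⟨Q, hQ, rfl⟩ := TropProof.Dtilde_elim hc hE
  exact TropProof.uniq hc hQ hP
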